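/- arXiv:1202.2092 — 2 statements merged into one kernel-verified Lean document; each statement's English description precedes it below -/
import Mathlib

section
/- There exists a constant C > 0 such that the following holds for every n ≥ 2, every connected initial graph G₀ on n vertices, and every vertex u such that some vertex v₀ ∈ N₀¹(u) is strongly tied to N₀²(u) at time 0. Let T = ⌈C·n·ln n⌉. Then the probability (over the trajectory of the triangulation process started at G₀) of the event that both (i) for every round t < T, fewer than δ₀/3 vertices of N_t¹(u) are strongly tied to N_t²(u), and (ii) d_T(u) < (1 + 1/8)·δ₀, is at most 1/n². -/
open scoped Classical

noncomputable section

variable {V : Type} [Fintype V] [DecidableEq V]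

/-- The neighbors of `v` in `G`, as a `Finset`. -/
def nbr (G : SimpleGraph V) (v : V) : Finset V := Finset.univ.filter (fun w => G.Adj v w)

/-- The degree `d(v)` of `v` in `G`. -/
def deg (G : SimpleGraph V) (v : V) : ℕ := (nbr G v).card

/-- The minimum degree of `G`. -/
def minDeg (G : SimpleGraph V) : ℕ := sInf (Set.range (deg G))

/-- `Nk G u i` is the set `Nⁱ(u)` of vertices at graph distance exactly `i` from `u`. -/
def Nk (G : SimpleGraph V) (u : V) (i : ℕ) : Finset V :=
  Finset.univ.filter (fun v => v ≠ u ∧ G.dist u v = i)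

/-- `degIn G v S` is `d(v, S)`, the number of neighbors of `v` lying in `S`. -/
def degIn (G : SimpleGraph V) (v : V) (S : Finset V) : ℕ := (nbr G v ∩ S).card

/-- The graph obtained from a choice function `c` in one round of the triangulation
process: every vertex `w` adds the edge joining the ordered pair `c w` of its chosen
neighbors (edges are unordered, loops are discarded, all additions are simultaneous). -/
def triNext (G : SimpleGraph V) (c : V → V × V) : SimpleGraph V :=
  G ⊔ SimpleGraph.fromEdgeSet {e | ∃ v : V, e = s((c v).1, (c v).2)}

/-- The probability that in one round of the triangulation process on the current
graph `G` the vertices make exactly the choices recorded by `c`: each vertex with at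
least one neighbor independently picks an ordered pair of its neighbors uniformly at
random with replacement; isolated vertices are given the dummy choice `(v, v)`. -/
def triWeight (G : SimpleGraph V) (c : V → V × V) : ℝ :=
  ∏ v : V,
    if deg G v = 0 then (if c v = (v, v) then 1 else 0)
    else if (c v).1 ∈ nbr G v ∧ (c v).2 ∈ nbr G v then (1 : ℝ) / (deg G v : ℝ) ^ 2 else 0

/-- Transition probability of one round of the triangulation process. -/
def triStep (G G' : SimpleGraph V) : ℝ :=
  ∑ c : V → V × V, if triNext G c = G' then triWeight G c else 0

/-- The graph obtained from a choice function `c` in one round of the two-hop walk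
process: every vertex `u` adds the edge to the endpoint `(c u).2` of its two-hop walk
(loops are discarded, all additions are simultaneous). -/
def hopNext (G : SimpleGraph V) (c : V → V × V) : SimpleGraph V :=
  G ⊔ SimpleGraph.fromEdgeSet {e | ∃ u : V, e = s(u, (c u).2)}

/-- The probability that in one round of the two-hop walk process on the current graph
`G` the vertices make exactly the choices recorded by `c`: each vertex `u` with at
least one neighbor independently picks a uniformly random neighbor `v = (c u).1` and
then a uniformly random neighbor `w = (c u).2` of `v`; isolated vertices are given the
dummy choice `(u, u)`. -/
def hopWeight (G : SimpleGraph V) (c : V → V × V) : ℝ :=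
  ∏ u : V,
    if deg G u = 0 then (if c u = (u, u) then 1 else 0)
    else if (c u).1 ∈ nbr G u ∧ (c u).2 ∈ nbr G (c u).1
      then (1 : ℝ) / ((deg G u : ℝ) * (deg G (c u).1 : ℝ)) else 0

/-- Transition probability of one round of the two-hop walk process. -/
def hopStep (G G' : SimpleGraph V) : ℝ :=
  ∑ c : V → V × V, if hopNext G c = G' then hopWeight G c else 0

/-- `trajProb step g0 T E` is the probability, for the Markov chain on a finite state
space `Γ` with one-step transition probabilities `step` started at `g0`, that the
trajectory `(g_0, g_1, …, g_T)` satisfies the event `E`; probabilities are realized as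
a probability mass function on finite sequences of states.  (The trajectory is passed
to `E` as a function on `ℕ`, frozen at time `T`.) -/
def trajProb {Γ : Type} [Fintype Γ] (step : Γ → Γ → ℝ) (g0 : Γ) (T : ℕ)
    (E : (ℕ → Γ) → Prop) : ℝ :=
  ∑ s : Fin (T + 1) → Γ,
    if s 0 = g0 ∧ E (fun t => s ⟨min t T, Nat.lt_succ_of_le (Nat.min_le_right t T)⟩)
    then ∏ t : Fin T, step (s t.castSucc) (s t.succ) else 0

end

noncomputable section

section TrajectoryBound

/-- The total weight, discounted by `Φ` at the final state, of the trajectories of length `T` from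
`g` that satisfy `P` at every time before `T`. -/
def constrainedSum {Γ : Type} [Fintype Γ] (step : Γ → Γ → ℝ) (P : Γ → Prop) (Φ : Γ → ℝ)
    (T : ℕ) (g : Γ) : ℝ :=
  ∑ s : Fin (T + 1) → Γ,
    if s 0 = g ∧ ∀ t : Fin T, P (s t.castSucc)
    then (∏ t : Fin T, step (s t.castSucc) (s t.succ)) * Φ (s (Fin.last T)) else 0

lemma constrainedSum_zero {Γ : Type} [Fintype Γ] (step : Γ → Γ → ℝ) (P : Γ → Prop)
    (Φ : Γ → ℝ) (g : Γ) : constrainedSum step P Φ 0 g = Φ g := by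
  unfold constrainedSum
  rw [← (Equiv.funUnique (Fin 1) Γ).symm.sum_comp]
  simp

lemma constrainedSum_succ {Γ : Type} [Fintype Γ] (step : Γ → Γ → ℝ) (P : Γ → Prop)
    (Φ : Γ → ℝ) (T : ℕ) (g : Γ) :
    constrainedSum step P Φ (T + 1) g =
      if P g then ∑ g', step g g' * constrainedSum step P Φ T g' else 0 := by
  unfold constrainedSum
  rw [← (Fin.consEquiv (fun _ : Fin (T + 2) => Γ)).sum_comp, Fintype.sum_prod_type]
  rw [Finset.sum_eq_single g]
  · split_ifs with hP
    · simp_rw [Finset.mul_sum]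
      rw [Finset.sum_comm]
      refine Finset.sum_congr rfl fun s _ => ?_
      rw [Finset.sum_eq_single (s 0)]
      · simp only [Fin.consEquiv_apply, Fin.forall_fin_succ (n := T),
          Fin.prod_univ_succ (n := T), Fin.cons_zero, Fin.castSucc_zero, Fin.cons_succ,
          ← Fin.succ_castSucc, ← Fin.succ_last, hP, true_and]
        split_ifs <;> ring
      · intro b _ hb
        simp [hb.symm]
      · simp
    · refine Finset.sum_eq_zero fun s _ => if_neg ?_
      rintro ⟨-, h⟩
      exact hP (by simpa using h 0)
  · intro b _ hb
    refine Finset.sum_eq_zero fun s _ => if_neg ?_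
    rintro ⟨h, -⟩
    exact hb (by simpa using h)
  · simp

lemma constrainedSum_le {Γ : Type} [Fintype Γ] {step : Γ → Γ → ℝ} {P I : Γ → Prop}
    {Φ : Γ → ℝ} {r : ℝ} (hr : 0 ≤ r) (hstep : ∀ g g', 0 ≤ step g g')
    (hI : ∀ g g', step g g' ≠ 0 → I g → I g') (hΦ : ∀ g, 0 ≤ Φ g)
    (hdrift : ∀ g, I g → P g → ∑ g', step g g' * Φ g' ≤ r * Φ g) (T : ℕ) :
    ∀ g, I g → constrainedSum step P Φ T g ≤ r ^ T * Φ g := by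
  induction T with
  | zero => intro g _; simp [constrainedSum_zero]
  | succ T ih =>
    intro g hg
    rw [constrainedSum_succ]
    split_ifs with hP
    · calc ∑ g', step g g' * constrainedSum step P Φ T g'
          ≤ ∑ g', r ^ T * (step g g' * Φ g') := by
            refine Finset.sum_le_sum fun g' _ => ?_
            by_cases h0 : step g g' = 0
            · simp [h0]
            · calc _ ≤ step g g' * (r ^ T * Φ g') :=
                    mul_le_mul_of_nonneg_left (ih g' (hI g g' h0 hg)) (hstep g g')
                _ = _ := by ring
        _ = r ^ T * ∑ g', step g g' * Φ g' := by rw [Finset.mul_sum]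
        _ ≤ r ^ T * (r * Φ g) :=
            mul_le_mul_of_nonneg_left (hdrift g hg hP) (pow_nonneg hr T)
        _ = _ := by ring
    · exact mul_nonneg (pow_nonneg hr _) (hΦ g)

/-- If along every trajectory of positive weight the event `E` forces `P` before time `T` and the
potential `Φ` is at least `m` at time `T`, then a multiplicative drift of `Φ` under `P` bounds the
probability of `E`. -/
lemma trajProb_le_of_drift {Γ : Type} [Fintype Γ] {step : Γ → Γ → ℝ} {P I : Γ → Prop}
    {Φ : Γ → ℝ} {r m : ℝ} (hr : 0 ≤ r) (hm : 0 < m) (hstep : ∀ g g', 0 ≤ step g g')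
    (hI : ∀ g g', step g g' ≠ 0 → I g → I g') (hΦ : ∀ g, 0 ≤ Φ g) (hΦm : ∀ g, I g → m ≤ Φ g)
    (hdrift : ∀ g, I g → P g → ∑ g', step g g' * Φ g' ≤ r * Φ g) (T : ℕ) (g0 : Γ) (hg0 : I g0)
    (E : (ℕ → Γ) → Prop)
    (hE : ∀ s : ℕ → Γ, (∀ t < T, step (s t) (s (t + 1)) ≠ 0) → E s → ∀ t < T, P (s t)) :
    trajProb step g0 T E ≤ m⁻¹ * (r ^ T * Φ g0) := by
  refine le_trans ?_ (mul_le_mul_of_nonneg_left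
    (constrainedSum_le hr hstep hI hΦ hdrift T g0 hg0) (inv_nonneg.2 hm.le))
  unfold trajProb constrainedSum
  rw [Finset.mul_sum]
  refine Finset.sum_le_sum fun s _ => ?_
  have hnn : 0 ≤ ∏ t : Fin T, step (s t.castSucc) (s t.succ) :=
    Finset.prod_nonneg fun _ _ => hstep _ _
  split_ifs with h h'
  · have hstep0 : ∀ t : Fin T, I (s t.castSucc) → I (s t.succ) ∨
        ∏ t : Fin T, step (s t.castSucc) (s t.succ) = 0 := by
      intro t ht
      by_cases h0 : step (s t.castSucc) (s t.succ) = 0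
      · exact Or.inr (Finset.prod_eq_zero (Finset.mem_univ t) h0)
      · exact Or.inl (hI _ _ h0 ht)
    by_cases hp : ∏ t : Fin T, step (s t.castSucc) (s t.succ) = 0
    · simp [hp]
    have hall : ∀ t : Fin (T + 1), I (s t) := by
      intro t
      induction t using Fin.induction with
      | zero => rw [h.1]; exact hg0
      | succ t ih => exact (hstep0 t ih).resolve_right hp
    calc ∏ t : Fin T, step (s t.castSucc) (s t.succ)
        = m⁻¹ * ((∏ t : Fin T, step (s t.castSucc) (s t.succ)) * m) := by
          field_simp
      _ ≤ _ := by
          gcongr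
          exact hΦm _ (hall _)
  · by_cases hp : ∏ t : Fin T, step (s t.castSucc) (s t.succ) = 0
    · simp [hp]
    exfalso
    refine h' ⟨h.1, fun t => ?_⟩
    have key := hE _ ?_ h.2 t t.2
    · have : (⟨min (t : ℕ) T, Nat.lt_succ_of_le (Nat.min_le_right t T)⟩ : Fin (T + 1))
          = t.castSucc := by
        ext; simp [t.2.le]
      rwa [this] at key
    · intro k hk h0
      refine hp (Finset.prod_eq_zero (Finset.mem_univ ⟨k, hk⟩) ?_)
      have h1 : (⟨min k T, Nat.lt_succ_of_le (Nat.min_le_right k T)⟩ : Fin (T + 1))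
          = (⟨k, hk⟩ : Fin T).castSucc := by
        ext; simp [hk.le]
      have h2 : (⟨min (k + 1) T, Nat.lt_succ_of_le (Nat.min_le_right (k + 1) T)⟩ : Fin (T + 1))
          = (⟨k, hk⟩ : Fin T).succ := by
        ext; simp; omega
      rwa [h1, h2] at h0
  · exact mul_nonneg (inv_nonneg.2 hm.le) (mul_nonneg hnn (hΦ _))
  · simp

end TrajectoryBound

section Basic

variable {V : Type}

lemma le_triNext (G : SimpleGraph V) (c : V → V × V) : G ≤ triNext G c := le_sup_left

lemma triNext_adj {G : SimpleGraph V} {c : V → V × V} {u w x : V} (h1 : (c w).1 = u)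
    (h2 : (c w).2 = x) (hne : u ≠ x) : (triNext G c).Adj u x := by
  refine Or.inr ?_
  rw [SimpleGraph.fromEdgeSet_adj]
  exact ⟨⟨w, by rw [h1, h2]⟩, hne⟩

variable [Fintype V]

lemma mem_nbr {G : SimpleGraph V} {v w : V} : w ∈ nbr G v ↔ G.Adj v w := by simp [nbr]

lemma nbr_mono {G H : SimpleGraph V} (h : G ≤ H) (v : V) : nbr G v ⊆ nbr H v := fun _ hw =>
  mem_nbr.2 (h (mem_nbr.1 hw))

lemma deg_mono {G H : SimpleGraph V} (h : G ≤ H) (v : V) : deg G v ≤ deg H v :=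
  Finset.card_le_card (nbr_mono h v)

lemma minDeg_le_deg (G : SimpleGraph V) (v : V) : minDeg G ≤ deg G v :=
  Nat.sInf_le ⟨v, rfl⟩

lemma deg_le_card (G : SimpleGraph V) (v : V) : deg G v ≤ Fintype.card V :=
  Finset.card_le_univ _

end Basic

section OneRound

variable {V : Type} [Fintype V] [DecidableEq V]

/-- The probability that vertex `v` makes the choice `p` in one round on `G`. -/
def choiceWeight (G : SimpleGraph V) (v : V) (p : V × V) : ℝ :=
  if deg G v = 0 then (if p = (v, v) then 1 else 0)
  else if p.1 ∈ nbr G v ∧ p.2 ∈ nbr G v then (1 : ℝ) / (deg G v : ℝ) ^ 2 else 0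

lemma triWeight_eq_prod (G : SimpleGraph V) (c : V → V × V) :
    triWeight G c = ∏ v, choiceWeight G v (c v) := rfl

lemma choiceWeight_nonneg (G : SimpleGraph V) (v : V) (p : V × V) : 0 ≤ choiceWeight G v p := by
  unfold choiceWeight
  split_ifs <;> positivity

lemma triWeight_nonneg (G : SimpleGraph V) (c : V → V × V) : 0 ≤ triWeight G c :=
  Finset.prod_nonneg fun _ _ => choiceWeight_nonneg _ _ _

lemma sum_choiceWeight (G : SimpleGraph V) (v : V) : ∑ p, choiceWeight G v p = 1 := by
  unfold choiceWeight
  by_cases h : deg G v = 0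
  · simp [h]
  · simp only [h, if_false, ← Finset.mem_product]
    rw [← Finset.sum_filter, Finset.filter_mem_eq_inter, Finset.univ_inter, Finset.sum_const,
      Finset.card_product]
    have h' : (deg G v : ℝ) ≠ 0 := by exact_mod_cast h
    rw [nsmul_eq_mul]
    change ((deg G v * deg G v : ℕ) : ℝ) * _ = 1
    push_cast
    field_simp

lemma sum_triWeight (G : SimpleGraph V) : ∑ c, triWeight G c = 1 := by
  simp_rw [triWeight_eq_prod]
  rw [← Fintype.prod_sum]
  simp [sum_choiceWeight]

lemma triStep_nonneg (G G' : SimpleGraph V) : 0 ≤ triStep G G' := by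
  refine Finset.sum_nonneg fun c _ => ?_
  split_ifs
  · exact triWeight_nonneg G c
  · exact le_rfl

lemma le_of_triStep_ne_zero {G G' : SimpleGraph V} (h : triStep G G' ≠ 0) : G ≤ G' := by
  obtain ⟨c, -, hc⟩ := Finset.exists_ne_zero_of_sum_ne_zero h
  have : triNext G c = G' := by
    by_contra hne
    simp [hne] at hc
  exact this ▸ le_triNext G c

lemma sum_triStep_mul (G : SimpleGraph V) (Φ : SimpleGraph V → ℝ) :
    ∑ G', triStep G G' * Φ G' = ∑ c, triWeight G c * Φ (triNext G c) := by
  unfold triStep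
  simp_rw [Finset.sum_mul]
  rw [Finset.sum_comm]
  refine Finset.sum_congr rfl fun c _ => ?_
  rw [Finset.sum_eq_single (triNext G c)]
  · simp
  · intro b _ hb
    simp [hb.symm]
  · simp

lemma sum_choiceWeight_miss (G : SimpleGraph V) {u w : V} (hw : G.Adj u w) (X : Finset V) :
    ∑ p, (if p.1 = u ∧ p.2 ∈ nbr G w ∩ X then 0 else choiceWeight G w p)
      = 1 - ((nbr G w ∩ X).card : ℝ) / (deg G w : ℝ) ^ 2 := by
  have hu : u ∈ nbr G w := mem_nbr.2 hw.symm
  have hd : deg G w ≠ 0 := (Finset.card_pos.2 ⟨u, hu⟩).ne'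
  have hsplit : ∀ p : V × V,
      (if p.1 = u ∧ p.2 ∈ nbr G w ∩ X then 0 else choiceWeight G w p) =
        choiceWeight G w p -
          if p ∈ ({u} : Finset V) ×ˢ (nbr G w ∩ X) then (1 : ℝ) / (deg G w : ℝ) ^ 2 else 0 := by
    intro p
    simp only [Finset.mem_product, Finset.mem_singleton]
    split_ifs with hp
    · have : p.1 ∈ nbr G w ∧ p.2 ∈ nbr G w := ⟨hp.1 ▸ hu, (Finset.mem_inter.1 hp.2).1⟩
      simp [choiceWeight, hd, this]
    · simp
  simp_rw [hsplit]
  rw [Finset.sum_sub_distrib, sum_choiceWeight, ← Finset.sum_filter, Finset.filter_mem_eq_inter,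
    Finset.univ_inter, Finset.sum_const, Finset.card_product, Finset.card_singleton, one_mul,
    nsmul_eq_mul, mul_one_div]

/-- The probability that no `w ∈ W` chooses a pair `(u, x)` with `x ∈ X` is exponentially small
in the sum of the individual probabilities. -/
lemma sum_triWeight_miss_le (G : SimpleGraph V) (u : V) (W X : Finset V)
    (hW : ∀ w ∈ W, G.Adj u w) :
    ∑ c, (if ∃ w ∈ W, (c w).1 = u ∧ (c w).2 ∈ nbr G w ∩ X then 0 else triWeight G c)
      ≤ Real.exp (-∑ w ∈ W, ((nbr G w ∩ X).card : ℝ) / (deg G w : ℝ) ^ 2) := by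
  have hprod : ∀ c : V → V × V,
      (if ∃ w ∈ W, (c w).1 = u ∧ (c w).2 ∈ nbr G w ∩ X then 0 else triWeight G c) =
        ∏ v, (if v ∈ W ∧ (c v).1 = u ∧ (c v).2 ∈ nbr G v ∩ X then 0
          else choiceWeight G v (c v)) := by
    intro c
    split_ifs with h
    · obtain ⟨w, hw, h⟩ := h
      symm
      exact Finset.prod_eq_zero (Finset.mem_univ w) (if_pos ⟨hw, h⟩)
    · rw [triWeight_eq_prod]
      refine Finset.prod_congr rfl fun v _ => (if_neg ?_).symm
      exact fun hv => h ⟨v, hv⟩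
  simp_rw [hprod]
  rw [← Fintype.prod_sum (fun v p => if v ∈ W ∧ p.1 = u ∧ p.2 ∈ nbr G v ∩ X then 0
          else choiceWeight G v p), ← Finset.sum_neg_distrib, Real.exp_sum,
    ← Finset.prod_subset (Finset.subset_univ W)]
  · refine Finset.prod_le_prod (fun w _ => Finset.sum_nonneg fun p _ => ?_) fun w hw => ?_
    · split_ifs
      · exact le_rfl
      · exact choiceWeight_nonneg _ _ _
    · simp only [hw, true_and]
      rw [sum_choiceWeight_miss G (hW w hw)]
      linarith [Real.add_one_le_exp (-(((nbr G w ∩ X).card : ℝ) / (deg G w : ℝ) ^ 2))]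
  · intro w _ hw
    simp only [hw, false_and, if_false]
    exact sum_choiceWeight G w

/-- If a potential never increases and drops by the factor `1 - β` as soon as some `w ∈ W` links
`u` to a vertex of `X`, then its expected value drops accordingly. -/
lemma sum_triStep_mul_le (G : SimpleGraph V) (u : V) (W X : Finset V)
    (hW : ∀ w ∈ W, G.Adj u w) (hX : u ∉ X) (Φ : SimpleGraph V → ℝ) {β s : ℝ} (hβ : 0 ≤ β)
    (hs : s ≤ ∑ w ∈ W, ((nbr G w ∩ X).card : ℝ) / (deg G w : ℝ) ^ 2) (hΦ : 0 ≤ Φ G)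
    (hmono : ∀ H, G ≤ H → Φ H ≤ Φ G)
    (hdrop : ∀ H, G ≤ H → (∃ x ∈ X, H.Adj u x) → Φ H ≤ (1 - β) * Φ G) :
    ∑ G', triStep G G' * Φ G' ≤ (1 - β * (1 - Real.exp (-s))) * Φ G := by
  rw [sum_triStep_mul]
  calc ∑ c, triWeight G c * Φ (triNext G c)
      ≤ ∑ c, ((1 - β) * triWeight G c +
          β * (if ∃ w ∈ W, (c w).1 = u ∧ (c w).2 ∈ nbr G w ∩ X then 0 else triWeight G c))
          * Φ G := by
        refine Finset.sum_le_sum fun c _ => ?_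
        split_ifs with h
        · obtain ⟨w, -, h1, h2⟩ := h
          have hx := (Finset.mem_inter.1 h2).2
          have := hdrop _ (le_triNext G c)
            ⟨_, hx, triNext_adj h1 rfl fun h => hX (h ▸ hx)⟩
          nlinarith [triWeight_nonneg G c]
        · nlinarith [triWeight_nonneg G c, hmono _ (le_triNext G c)]
    _ = ((1 - β) * 1 + β * ∑ c, (if ∃ w ∈ W, (c w).1 = u ∧ (c w).2 ∈ nbr G w ∩ X then 0
          else triWeight G c)) * Φ G := by
        rw [← Finset.sum_mul, Finset.sum_add_distrib, ← Finset.mul_sum, ← Finset.mul_sum,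
          sum_triWeight]
    _ ≤ _ := by
        refine mul_le_mul_of_nonneg_right ?_ hΦ
        have h1 := (sum_triWeight_miss_le G u W X hW).trans
          (Real.exp_le_exp.2 (neg_le_neg hs))
        nlinarith

end OneRound

section Neighborhoods

variable {V : Type} [Fintype V] [DecidableEq V]

lemma Nk_one (G : SimpleGraph V) (u : V) : Nk G u 1 = nbr G u := by
  ext v
  simp only [Nk, nbr, Finset.mem_filter, Finset.mem_univ, true_and,
    SimpleGraph.dist_eq_one_iff_adj]
  exact ⟨And.right, fun h => ⟨h.ne', h⟩⟩

lemma not_adj_of_mem_Nk_two {G : SimpleGraph V} {u x : V} (h : x ∈ Nk G u 2) :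
    x ≠ u ∧ ¬ G.Adj u x := by
  simp only [Nk, Finset.mem_filter, Finset.mem_univ, true_and] at h
  refine ⟨h.1, fun hadj => ?_⟩
  have := SimpleGraph.dist_eq_one_iff_adj.2 hadj
  omega

lemma mem_Nk_two {G : SimpleGraph V} {u y x : V} (hy : G.Adj u y) (hx : G.Adj y x) (hne : x ≠ u)
    (hnadj : ¬ G.Adj u x) : x ∈ Nk G u 2 := by
  simp only [Nk, Finset.mem_filter, Finset.mem_univ, true_and]
  refine ⟨hne, ?_⟩
  have h2 : G.dist u x ≤ 2 := SimpleGraph.dist_le (.cons hy (.cons hx .nil))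
  have h1 : G.dist u x ≠ 1 := fun h => hnadj (SimpleGraph.dist_eq_one_iff_adj.1 h)
  have h0 : G.dist u x ≠ 0 :=
    ((hy.reachable.trans hx.reachable).pos_dist_of_ne hne.symm).ne'
  omega

lemma deg_le_add_degIn_Nk_two {G : SimpleGraph V} {u y : V} (hy : G.Adj u y) :
    deg G y ≤ deg G u + degIn G y (Nk G u 2) := by
  have hsub : nbr G y ⊆ insert u ((nbr G u).erase y) ∪ (nbr G y ∩ Nk G u 2) := by
    intro x hx
    have hx' := mem_nbr.1 hx
    simp only [Finset.mem_union, Finset.mem_insert, Finset.mem_erase, Finset.mem_inter, hx,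
      true_and, mem_nbr]
    by_cases h1 : x = u
    · exact Or.inl (Or.inl h1)
    by_cases h2 : G.Adj u x
    · exact Or.inl (Or.inr ⟨hx'.ne', h2⟩)
    · exact Or.inr (mem_Nk_two hy hx' h1 h2)
  have h1 := (Finset.card_le_card hsub).trans (Finset.card_union_le _ _)
  have h2 := Finset.card_insert_le u ((nbr G u).erase y)
  have h3 := Finset.card_erase_add_one (mem_nbr.2 hy)
  unfold deg degIn
  omega

/-- The number of neighbors of `x` in `G` outside the closed neighborhood of `u` in `G0`. -/
def outDeg (G0 : SimpleGraph V) (u : V) (G : SimpleGraph V) (x : V) : ℕ :=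
  (nbr G x \ insert u (nbr G0 u)).card

lemma outDeg_mono {G0 G H : SimpleGraph V} {u : V} (h : G ≤ H) (x : V) :
    outDeg G0 u G x ≤ outDeg G0 u H x :=
  Finset.card_le_card (Finset.sdiff_subset_sdiff (nbr_mono h x) le_rfl)

/-- The neighbors of `u` in `G` having at least half of the initial minimum degree many
neighbors outside the initial closed neighborhood of `u`. -/
def expanders (G0 : SimpleGraph V) (u : V) (G : SimpleGraph V) : Finset V :=
  (nbr G u).filter fun y => (minDeg G0 : ℝ) / 2 ≤ outDeg G0 u G y

lemma expanders_mono {G0 G H : SimpleGraph V} {u : V} (h : G ≤ H) :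
    expanders G0 u G ⊆ expanders G0 u H := by
  intro y hy
  simp only [expanders, Finset.mem_filter] at hy ⊢
  refine ⟨nbr_mono h u hy.1, hy.2.trans ?_⟩
  exact_mod_cast outDeg_mono h y

lemma outDeg_le_degIn_add {G0 G : SimpleGraph V} (h : G0 ≤ G) {u y : V} (hy : G.Adj u y) :
    outDeg G0 u G y + deg G0 u ≤ degIn G y (Nk G u 2) + deg G u := by
  have hsub : nbr G y \ insert u (nbr G0 u) ⊆ (nbr G y ∩ Nk G u 2) ∪ (nbr G u \ nbr G0 u) := by
    intro x hx
    simp only [Finset.mem_sdiff, Finset.mem_insert, not_or, Finset.mem_union,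
      Finset.mem_inter] at hx ⊢
    by_cases h2 : G.Adj u x
    · exact Or.inr ⟨mem_nbr.2 h2, hx.2.2⟩
    · exact Or.inl ⟨hx.1, mem_Nk_two hy (mem_nbr.1 hx.1) hx.2.1 h2⟩
  have h1 := (Finset.card_le_card hsub).trans (Finset.card_union_le _ _)
  have h2 := Finset.card_sdiff_add_card_eq_card (nbr_mono h u)
  unfold deg degIn outDeg
  omega

lemma degIn_le_outDeg (G0 : SimpleGraph V) (u y : V) :
    degIn G0 y (Nk G0 u 2) ≤ outDeg G0 u G0 y := by
  refine Finset.card_le_card fun x hx => ?_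
  rw [Finset.mem_inter] at hx
  have := not_adj_of_mem_Nk_two hx.2
  simp [hx.1, this, mem_nbr]

/-- The state of the process before success: few neighbors of `u` are strongly tied to the
second neighborhood, and the degree of `u` is small. -/
def Stalled (G0 : SimpleGraph V) (u : V) (G : SimpleGraph V) : Prop :=
  (((Nk G u 1).filter (fun v =>
      (minDeg G0 : ℝ) / 2 ≤ (degIn G v (Nk G u 2) : ℝ))).card : ℝ) < (minDeg G0 : ℝ) / 3
  ∧ (deg G u : ℝ) < (1 + 1/8) * (minDeg G0 : ℝ)

/-- If the second neighborhood contains few non-expanding vertices, then the expanders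
recruit further expanding vertices at a rate proportional to their number. -/
lemma expander_rate {G0 G : SimpleGraph V} {u : V} (hG : G0 ≤ G) (hst : Stalled G0 u G)
    (hfew : (((Nk G u 2).filter fun x => (outDeg G0 u G x : ℝ) < minDeg G0 / 2).card : ℝ)
      < minDeg G0 / 8) :
    ((expanders G0 u G).card : ℝ) / (127 * Fintype.card V) ≤
      ∑ w ∈ expanders G0 u G, ((nbr G w ∩
        (Nk G u 2).filter fun x => (minDeg G0 : ℝ) / 2 ≤ outDeg G0 u G x).card : ℝ)
          / (deg G w : ℝ) ^ 2 := by
  rw [div_eq_mul_one_div, ← nsmul_eq_mul]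
  refine Finset.card_nsmul_le_sum _ _ _ fun y hy => ?_
  simp only [expanders, Finset.mem_filter, mem_nbr] at hy
  obtain ⟨hy, hout⟩ := hy
  have hdeg : (deg G y : ℝ) ≤ deg G u + degIn G y (Nk G u 2) := by
    exact_mod_cast deg_le_add_degIn_Nk_two hy
  have hin : (outDeg G0 u G y : ℝ) + deg G0 u ≤ degIn G y (Nk G u 2) + deg G u := by
    exact_mod_cast outDeg_le_degIn_add hG hy
  have hmin : (minDeg G0 : ℝ) ≤ deg G0 u := by exact_mod_cast minDeg_le_deg G0 u
  have hu := hst.2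
  have hpos : 0 < deg G y := Finset.card_pos.2 ⟨u, mem_nbr.2 hy.symm⟩
  have hpos' : (0 : ℝ) < deg G y := by exact_mod_cast hpos
  have hcard : (deg G y : ℝ) ≤ Fintype.card V := by exact_mod_cast deg_le_card G y
  set X := (Nk G u 2).filter fun x => (minDeg G0 : ℝ) / 2 ≤ outDeg G0 u G x with hX
  set B := (Nk G u 2).filter fun x => (outDeg G0 u G x : ℝ) < minDeg G0 / 2 with hB
  have hsplit : (degIn G y (Nk G u 2) : ℝ) ≤ (nbr G y ∩ X).card + B.card := by
    have hsub : nbr G y ∩ Nk G u 2 ⊆ (nbr G y ∩ X) ∪ B := by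
      intro x hx
      rw [Finset.mem_inter] at hx
      simp only [hX, hB, Finset.mem_union, Finset.mem_inter, Finset.mem_filter, hx.1, hx.2,
        true_and]
      exact le_or_gt _ _
    exact_mod_cast (Finset.card_le_card hsub).trans (Finset.card_union_le _ _)
  rw [div_le_div_iff₀ (by linarith) (by positivity)]
  have hg : (deg G y : ℝ) ≤ 10 * (nbr G y ∩ X).card := by linarith
  nlinarith

/-- If the second neighborhood contains many non-expanding vertices, then the weakly tied
neighbors of `u` link `u` to one of them with constant probability. -/
lemma weakly_tied_rate {G0 G : SimpleGraph V} {u : V} (hG : G0 ≤ G) (hst : Stalled G0 u G)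
    (hmany : (minDeg G0 : ℝ) / 8 ≤
      (((Nk G u 2).filter fun x => (outDeg G0 u G x : ℝ) < minDeg G0 / 2).card : ℝ)) :
    (1 : ℝ) / 127 ≤
      ∑ w ∈ (nbr G u).filter fun v => (degIn G v (Nk G u 2) : ℝ) < minDeg G0 / 2,
        ((nbr G w ∩
          (Nk G u 2).filter fun x => (outDeg G0 u G x : ℝ) < minDeg G0 / 2).card : ℝ)
            / (deg G w : ℝ) ^ 2 := by
  set B := (Nk G u 2).filter fun x => (outDeg G0 u G x : ℝ) < minDeg G0 / 2 with hB
  set W := (nbr G u).filter fun v => (degIn G v (Nk G u 2) : ℝ) < minDeg G0 / 2 with hW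
  obtain ⟨hstrong, hu⟩ := hst
  rw [Nk_one] at hstrong
  have hD : (0 : ℝ) < minDeg G0 := by
    have : (0 : ℝ) ≤ deg G u := by positivity
    linarith
  have hbad : ∀ x ∈ B, (minDeg G0 : ℝ) / 6 ≤ (nbr G x ∩ W).card := by
    intro x hx
    simp only [hB, Finset.mem_filter] at hx
    have hx2 := not_adj_of_mem_Nk_two hx.1
    have hsub : nbr G x \ (nbr G x \ insert u (nbr G0 u)) ⊆ (nbr G x ∩ W) ∪
        (nbr G u).filter fun v => (minDeg G0 : ℝ) / 2 ≤ degIn G v (Nk G u 2) := by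
      intro y hy
      simp only [Finset.mem_sdiff, Finset.mem_insert, not_and, not_not] at hy
      have hyu : y ∈ nbr G u := by
        rcases hy.2 hy.1 with rfl | h
        · exact absurd (mem_nbr.1 hy.1).symm hx2.2
        · exact nbr_mono hG u h
      simp only [hW, Finset.mem_union, Finset.mem_inter, Finset.mem_filter, hy.1, hyu, true_and]
      exact lt_or_ge _ _
    have h1 := (Finset.card_le_card hsub).trans (Finset.card_union_le _ _)
    have h2 := Finset.card_sdiff_add_card_eq_card
      (Finset.sdiff_subset : nbr G x \ insert u (nbr G0 u) ⊆ nbr G x)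
    have h3 : minDeg G0 ≤ (nbr G x).card := (minDeg_le_deg G0 x).trans (deg_mono hG x)
    have h4 : (minDeg G0 : ℝ) ≤ (nbr G x ∩ W).card +
        ((nbr G u).filter fun v => (minDeg G0 : ℝ) / 2 ≤ degIn G v (Nk G u 2)).card
        + outDeg G0 u G x := by
      unfold outDeg
      exact_mod_cast (by omega)
    linarith [hx.2]
  have hdouble : ∑ w ∈ W, (nbr G w ∩ B).card = ∑ x ∈ B, (nbr G x ∩ W).card := by
    have := Finset.sum_card_bipartiteAbove_eq_sum_card_bipartiteBelow
      (s := W) (t := B) (fun w x => G.Adj w x)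
    convert this using 3 with w _ x _
    · ext z
      simp [Finset.bipartiteAbove, mem_nbr, and_comm]
    · ext z
      simp [Finset.bipartiteBelow, mem_nbr, and_comm, SimpleGraph.adj_comm]
  have hcount : (minDeg G0 : ℝ) / 8 * (minDeg G0 / 6) ≤ ∑ w ∈ W, ((nbr G w ∩ B).card : ℝ) := by
    calc (minDeg G0 : ℝ) / 8 * (minDeg G0 / 6) ≤ B.card * (minDeg G0 / 6 : ℝ) := by gcongr
      _ ≤ ∑ x ∈ B, ((nbr G x ∩ W).card : ℝ) := by
          rw [← nsmul_eq_mul]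
          exact Finset.card_nsmul_le_sum _ _ _ hbad
      _ = _ := by exact_mod_cast hdouble.symm
  calc (1 : ℝ) / 127 ≤ (minDeg G0 : ℝ) / 8 * (minDeg G0 / 6) / (13 / 8 * minDeg G0) ^ 2 := by
        rw [le_div_iff₀ (by positivity)]
        nlinarith [sq_nonneg (minDeg G0 : ℝ)]
    _ ≤ (∑ w ∈ W, ((nbr G w ∩ B).card : ℝ)) / (13 / 8 * minDeg G0) ^ 2 := by gcongr
    _ = ∑ w ∈ W, ((nbr G w ∩ B).card : ℝ) / (13 / 8 * minDeg G0) ^ 2 := by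
        rw [Finset.sum_div]
    _ ≤ _ := by
        refine Finset.sum_le_sum fun w hw => ?_
        simp only [hW, Finset.mem_filter, mem_nbr] at hw
        have hpos : 0 < deg G w := Finset.card_pos.2 ⟨u, mem_nbr.2 hw.1.symm⟩
        have hdeg : (deg G w : ℝ) ≤ deg G u + degIn G w (Nk G u 2) := by
          exact_mod_cast deg_le_add_degIn_Nk_two hw.1
        gcongr
        linarith [hw.2]

/-- The potential whose expected value decays while the process is stalled. -/
def potential (G0 : SimpleGraph V) (u : V) (G : SimpleGraph V) : ℝ :=
  1 / ((expanders G0 u G).card * deg G u)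

lemma potential_nonneg (G0 : SimpleGraph V) (u : V) (G : SimpleGraph V) :
    0 ≤ potential G0 u G := by
  unfold potential
  positivity

lemma one_sub_exp_neg_ge {x : ℝ} (h0 : 0 ≤ x) (h1 : x ≤ 1) : x / 2 ≤ 1 - Real.exp (-x) := by
  have h := Real.add_one_le_exp x
  have h2 : Real.exp (-x) ≤ 1 / (1 + x) := by
    rw [Real.exp_neg, ← one_div]
    exact one_div_le_one_div_of_le (by linarith) (by linarith)
  have h3 : 1 / (1 + x) ≤ 1 - x / 2 := by
    rw [div_le_iff₀ (by linarith)]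
    nlinarith
  linarith

lemma one_div_mul_le {a b a' b' : ℝ} (ha : 1 ≤ a) (hb : 1 ≤ b) (ha' : a + 1 ≤ a')
    (hb' : b ≤ b') : 1 / (a' * b') ≤ (1 - 1 / (2 * a)) * (1 / (a * b)) := by
  have h1 : 1 / (a' * b') ≤ 1 / ((a + 1) * b) :=
    one_div_le_one_div_of_le (by positivity)
      (mul_le_mul ha' hb' (by linarith) (by linarith))
  refine h1.trans ?_
  have h2 : 1 / (a + 1) ≤ (1 - 1 / (2 * a)) * (1 / a) := by
    have : (1 - 1 / (2 * a)) * (1 / a) = (2 * a - 1) / (2 * a ^ 2) := by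
      field_simp
    rw [this, div_le_div_iff₀ (by positivity) (by positivity)]
    nlinarith
  have h3 : (0 : ℝ) ≤ 1 / b := by positivity
  calc 1 / ((a + 1) * b) = 1 / (a + 1) * (1 / b) := by rw [one_div_mul_one_div]
    _ ≤ (1 - 1 / (2 * a)) * (1 / a) * (1 / b) := by gcongr
    _ = _ := by rw [mul_assoc, one_div_mul_one_div]

lemma rate_le {a n s : ℝ} (ha : 1 ≤ a) (han : a ≤ n) (hs : s = a / (127 * n)) :
    1 - 1 / (2 * a) * (1 - Real.exp (-s)) ≤ 1 - 1 / (508 * n) := by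
  have hn : 0 < n := by linarith
  have h0 : 0 ≤ s := by rw [hs]; positivity
  have h1 : s ≤ 1 := by
    rw [hs, div_le_one (by positivity)]
    linarith
  have h2 := one_sub_exp_neg_ge h0 h1
  have h3 : 1 / (508 * n) = 1 / (2 * a) * (s / 2) := by
    rw [hs]
    field_simp
    norm_num
  rw [h3]
  gcongr

lemma potential_drift {G0 G : SimpleGraph V} {u : V} (hG : G0 ≤ G)
    (hne : (expanders G0 u G).Nonempty) (hst : Stalled G0 u G) :
    ∑ G', triStep G G' * potential G0 u G' ≤
      (1 - 1 / (508 * (Fintype.card V : ℝ))) * potential G0 u G := by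
  have hLpos : 1 ≤ (expanders G0 u G).card := hne.card_pos
  have hLdeg : (expanders G0 u G).card ≤ deg G u := Finset.card_filter_le _ _
  have hL1 : (1 : ℝ) ≤ (expanders G0 u G).card := by exact_mod_cast hLpos
  have hd1 : (1 : ℝ) ≤ deg G u := by exact_mod_cast hLpos.trans hLdeg
  have hdn : (deg G u : ℝ) ≤ Fintype.card V := by exact_mod_cast deg_le_card G u
  have hLn : ((expanders G0 u G).card : ℝ) ≤ Fintype.card V :=
    le_trans (by exact_mod_cast hLdeg) hdn
  have hLmono : ∀ H, G ≤ H → ((expanders G0 u G).card : ℝ) ≤ (expanders G0 u H).card :=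
    fun H h => by exact_mod_cast Finset.card_le_card (expanders_mono h)
  have hdmono : ∀ H, G ≤ H → (deg G u : ℝ) ≤ deg H u :=
    fun H h => by exact_mod_cast deg_mono h u
  have hmono : ∀ H, G ≤ H → potential G0 u H ≤ potential G0 u G := by
    intro H h
    refine one_div_le_one_div_of_le (by positivity) ?_
    exact mul_le_mul (hLmono H h) (hdmono H h) (by positivity) (by positivity)
  by_cases hfew : (((Nk G u 2).filter fun x => (outDeg G0 u G x : ℝ) < minDeg G0 / 2).card : ℝ)
      < minDeg G0 / 8
  · refine (sum_triStep_mul_le G u _ _ ?_ ?_ (potential G0 u)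
      (β := 1 / (2 * (expanders G0 u G).card)) (by positivity) (expander_rate hG hst hfew)
      (potential_nonneg _ _ _) hmono ?_).trans ?_
    · intro w hw
      exact mem_nbr.1 (Finset.mem_filter.1 hw).1
    · intro h
      exact (not_adj_of_mem_Nk_two (Finset.mem_filter.1 h).1).1 rfl
    · rintro H hH ⟨x, hx, hadj⟩
      rw [Finset.mem_filter] at hx
      refine one_div_mul_le hL1 hd1 ?_ (hdmono H hH)
      have hxn : x ∉ expanders G0 u G := fun h =>
        (not_adj_of_mem_Nk_two hx.1).2 (mem_nbr.1 (Finset.mem_filter.1 h).1)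
      have hsub : insert x (expanders G0 u G) ⊆ expanders G0 u H := by
        refine Finset.insert_subset ?_ (expanders_mono hH)
        refine Finset.mem_filter.2 ⟨mem_nbr.2 hadj, hx.2.trans ?_⟩
        exact_mod_cast outDeg_mono hH x
      have := Finset.card_le_card hsub
      rw [Finset.card_insert_of_notMem hxn] at this
      exact_mod_cast this
    · exact mul_le_mul_of_nonneg_right (rate_le hL1 hLn rfl) (potential_nonneg _ _ _)
  · have hs : (deg G u : ℝ) / (127 * Fintype.card V) ≤ 1 / 127 := by
      rw [div_le_div_iff₀ (by linarith) (by norm_num)]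
      linarith
    refine (sum_triStep_mul_le G u _ _ ?_ ?_ (potential G0 u)
      (β := 1 / (2 * deg G u)) (by positivity)
      (hs.trans (weakly_tied_rate hG hst (not_lt.1 hfew)))
      (potential_nonneg _ _ _) hmono ?_).trans ?_
    · intro w hw
      exact mem_nbr.1 (Finset.mem_filter.1 hw).1
    · intro h
      exact (not_adj_of_mem_Nk_two (Finset.mem_filter.1 h).1).1 rfl
    · rintro H hH ⟨x, hx, hadj⟩
      rw [Finset.mem_filter] at hx
      unfold potential
      rw [mul_comm ((expanders G0 u H).card : ℝ), mul_comm ((expanders G0 u G).card : ℝ)]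
      refine one_div_mul_le hd1 hL1 ?_ (hLmono H hH)
      have hxn : x ∉ nbr G u := fun h => (not_adj_of_mem_Nk_two hx.1).2 (mem_nbr.1 h)
      have hsub : insert x (nbr G u) ⊆ nbr H u :=
        Finset.insert_subset (mem_nbr.2 hadj) (nbr_mono hH u)
      have := Finset.card_le_card hsub
      rw [Finset.card_insert_of_notMem hxn] at this
      unfold deg
      exact_mod_cast this
    · exact mul_le_mul_of_nonneg_right (rate_le hd1 hdn rfl) (potential_nonneg _ _ _)

end Neighborhoods

lemma pow_ceil_le {n : ℕ} (hn : 2 ≤ n) :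
    (1 - 1 / (508 * (n : ℝ))) ^ ⌈(2032 : ℝ) * n * Real.log n⌉₊ ≤ 1 / (n : ℝ) ^ 4 := by
  have hn2 : (2 : ℝ) ≤ n := by exact_mod_cast hn
  have hn0 : (0 : ℝ) < n := by linarith
  have hr : 0 ≤ 1 - 1 / (508 * (n : ℝ)) := by
    rw [sub_nonneg, div_le_one (by positivity)]
    linarith
  have h1 : 1 - 1 / (508 * (n : ℝ)) ≤ Real.exp (-(1 / (508 * n))) := by
    linarith [Real.add_one_le_exp (-(1 / (508 * (n : ℝ))))]
  refine (pow_le_pow_left₀ hr h1 _).trans ?_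
  rw [← Real.exp_nat_mul]
  have h2 := Nat.le_ceil ((2032 : ℝ) * n * Real.log n)
  have h3 : (1 : ℝ) / (n : ℝ) ^ 4 = Real.exp (-(4 * Real.log n)) := by
    rw [Real.exp_neg, show (4 : ℝ) * Real.log n = ((4 : ℕ) : ℝ) * Real.log n by norm_num,
      Real.exp_nat_mul, Real.exp_log hn0, one_div]
  rw [h3, Real.exp_le_exp, mul_neg, neg_le_neg_iff]
  calc 4 * Real.log n = 2032 * n * Real.log n * (1 / (508 * n)) := by
        field_simp
        ring
    _ ≤ _ := by gcongr

end

/-- There is a constant `C > 0` such that for every `n ≥ 2`, every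
connected initial graph `G₀` on `n` vertices with minimum degree `δ₀`, and every vertex
`u` having some neighbor `v₀ ∈ N₀¹(u)` strongly tied to `N₀²(u)` at time `0`, with
`T = ⌈C·n·ln n⌉`: the probability, over the trajectory of the triangulation process
started at `G₀`, that both (i) for every round `t < T` fewer than `δ₀/3` vertices of
`N_t¹(u)` are strongly tied to `N_t²(u)`, and (ii) `d_T(u) < (1 + 1/8)·δ₀`, is at most
`1/n²`. -/
theorem triangulation_one_strongly_tied :
    ∃ C : ℝ, 0 < C ∧
      ∀ (V : Type) [Fintype V] [DecidableEq V] (n : ℕ), 2 ≤ n → Fintype.card V = n →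
        ∀ (G0 : SimpleGraph V), G0.Connected → ∀ u : V,
          (∃ v₀ ∈ Nk G0 u 1, (minDeg G0 : ℝ) / 2 ≤ (degIn G0 v₀ (Nk G0 u 2) : ℝ)) →
          ∀ T : ℕ, T = ⌈C * n * Real.log n⌉₊ →
            trajProb triStep G0 T (fun g =>
              (∀ t < T, (((Nk (g t) u 1).filter (fun v =>
                    (minDeg G0 : ℝ) / 2 ≤ (degIn (g t) v (Nk (g t) u 2) : ℝ))).card : ℝ)
                  < (minDeg G0 : ℝ) / 3)
              ∧ (deg (g T) u : ℝ) < (1 + 1/8) * (minDeg G0 : ℝ))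
            ≤ 1 / (n : ℝ) ^ 2 := by
  refine ⟨2032, by norm_num, ?_⟩
  intro V _ _ n hn hcard G0 _ u ⟨v₀, hv₀, htied⟩ T hT
  have hn2 : (2 : ℝ) ≤ n := by exact_mod_cast hn
  have hn0 : (0 : ℝ) < n := by linarith
  have hexp : ∀ G, G0 ≤ G → (expanders G0 u G).Nonempty := by
    intro G hG
    refine ⟨v₀, expanders_mono hG (Finset.mem_filter.2 ⟨Nk_one G0 u ▸ hv₀, htied.trans ?_⟩)⟩
    exact_mod_cast degIn_le_outDeg G0 u v₀
  have hprod : ∀ G, G0 ≤ G → (1 : ℝ) ≤ (expanders G0 u G).card * deg G u := by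
    intro G hG
    have h1 := (hexp G hG).card_pos
    have h2 : (expanders G0 u G).card ≤ deg G u := Finset.card_filter_le _ _
    exact_mod_cast Nat.mul_pos h1 (h1.trans_le h2)
  have hr : 0 ≤ 1 - 1 / (508 * (n : ℝ)) := by
    rw [sub_nonneg, div_le_one (by positivity)]
    linarith
  refine (trajProb_le_of_drift (P := Stalled G0 u) (I := fun G => G0 ≤ G)
    (Φ := potential G0 u) (r := 1 - 1 / (508 * (n : ℝ))) (m := 1 / (n : ℝ) ^ 2) hr
    (by positivity) triStep_nonneg (fun G G' h hG => hG.trans (le_of_triStep_ne_zero h))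
    (potential_nonneg G0 u) ?_ ?_ T G0 le_rfl _ ?_).trans ?_
  · intro G hG
    refine one_div_le_one_div_of_le (by linarith [hprod G hG]) ?_
    rw [sq, ← hcard]
    have h2 : (expanders G0 u G).card ≤ Fintype.card V := Finset.card_le_univ _
    have h3 := deg_le_card G u
    exact_mod_cast Nat.mul_le_mul h2 h3
  · intro G hG hst
    have := potential_drift hG (hexp G hG) hst
    rwa [hcard] at this
  · rintro s hs ⟨htie, hdeg⟩ t ht
    have hmono : ∀ k ≤ T, t ≤ k → s t ≤ s k := by
      intro k hk htk
      induction k, htk using Nat.le_induction with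
      | base => exact le_rfl
      | succ k _ ih =>
        exact (ih (by omega)).trans (le_of_triStep_ne_zero (hs k (by omega)))
    refine ⟨htie t ht, lt_of_le_of_lt ?_ hdeg⟩
    exact_mod_cast deg_mono (hmono T le_rfl ht.le) u
  · have hpow : (1 - 1 / (508 * (n : ℝ))) ^ T ≤ 1 / (n : ℝ) ^ 4 := hT ▸ pow_ceil_le hn
    have hΦ : potential G0 u G0 ≤ 1 := by
      unfold potential
      exact (div_le_one (by linarith [hprod G0 le_rfl])).2 (hprod G0 le_rfl)
    calc (1 / (n : ℝ) ^ 2)⁻¹ * ((1 - 1 / (508 * (n : ℝ))) ^ T * potential G0 u G0)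
        ≤ (1 / (n : ℝ) ^ 2)⁻¹ * (1 / (n : ℝ) ^ 4 * 1) := by
          gcongr
          exact potential_nonneg G0 u G0
      _ = 1 / (n : ℝ) ^ 2 := by
          field_simp
end

section
/- There exist constants C > 0 and C' > 0 such that for every n ≥ 2 and every connected initial graph G₀ on n vertices, after T = ⌈C·n·(ln n)²⌉ rounds of the triangulation process, the graph G_T is the complete graph on V with probability at least 1 − C'·(ln n)/n. -/
open scoped Classical

namespace Triangulation

noncomputable section

/-- Expectation of `f` after one step of the chain with transition probabilities `step`. -/
def markovOp {Γ : Type} [Fintype Γ] (step : Γ → Γ → ℝ) (f : Γ → ℝ) (g : Γ) : ℝ :=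
  ∑ g', step g g' * f g'

lemma sum_path_eq_iterate {Γ : Type} [Fintype Γ] (step : Γ → Γ → ℝ) (f : Γ → ℝ) (T : ℕ) (g0 : Γ) :
    (∑ s : Fin (T + 1) → Γ,
      if s 0 = g0 then f (s (Fin.last T)) * ∏ t : Fin T, step (s t.castSucc) (s t.succ) else 0) =
      (markovOp step)^[T] f g0 := by
  induction T generalizing g0 with
  | zero =>
    rw [← (Equiv.funUnique (Fin 1) Γ).symm.sum_comp]
    simp
  | succ T ih =>
    rw [Function.iterate_succ_apply', ← (Fin.consEquiv (fun _ : Fin (T + 2) => Γ)).sum_comp,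
      Fintype.sum_prod_type]
    simp only [markovOp, ← ih]
    simp only [Fin.consEquiv, Equiv.coe_fn_mk, Fin.cons_zero, Fin.prod_univ_succ, Fin.castSucc_zero,
      Fin.cons_succ, ← Fin.succ_last, Fin.castSucc_succ]
    rw [Finset.sum_eq_single g0 (by intro b _ hb; simp [hb]) (by simp)]
    simp only [if_true, Finset.mul_sum]
    rw [Finset.sum_comm]
    refine Finset.sum_congr rfl fun s _ => ?_
    rw [Finset.sum_eq_single (s 0) (by intro b _ hb; simp [hb.symm]) (by simp)]
    simp only [if_true]
    ring

lemma trajProb_eq_iterate {Γ : Type} [Fintype Γ] (step : Γ → Γ → ℝ) (g0 a : Γ) (T : ℕ) :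
    trajProb step g0 T (fun g => g T = a) =
      (markovOp step)^[T] (fun g => if g = a then 1 else 0) g0 := by
  rw [← sum_path_eq_iterate]
  refine Finset.sum_congr rfl fun s _ => ?_
  have h : (⟨min T T, Nat.lt_succ_of_le (Nat.min_le_right T T)⟩ : Fin (T + 1)) = Fin.last T := by
    ext; simp
  simp only [h]
  by_cases h0 : s 0 = g0 <;> by_cases h1 : s (Fin.last T) = a <;> simp [h0, h1]

variable {V : Type} [Fintype V] [DecidableEq V]

/-- Probability that a single vertex `v` makes the choice `p`. -/
def choiceWeight (G : SimpleGraph V) (v : V) (p : V × V) : ℝ :=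
  if deg G v = 0 then (if p = (v, v) then 1 else 0)
  else if p.1 ∈ nbr G v ∧ p.2 ∈ nbr G v then (1 : ℝ) / (deg G v : ℝ) ^ 2 else 0

lemma triWeight_eq (G : SimpleGraph V) (c : V → V × V) :
    triWeight G c = ∏ v, choiceWeight G v (c v) := rfl

lemma choiceWeight_nonneg (G : SimpleGraph V) (v : V) (p : V × V) : 0 ≤ choiceWeight G v p := by
  unfold choiceWeight; split_ifs <;> positivity

lemma triWeight_nonneg (G : SimpleGraph V) (c : V → V × V) : 0 ≤ triWeight G c :=
  Finset.prod_nonneg fun _ _ => choiceWeight_nonneg G _ _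

lemma sum_choiceWeight (G : SimpleGraph V) (v : V) : ∑ p, choiceWeight G v p = 1 := by
  unfold choiceWeight
  by_cases h : deg G v = 0
  · simp [h]
  · simp only [h, if_false]
    rw [← Finset.sum_filter]
    have : Finset.univ.filter (fun p : V × V => p.1 ∈ nbr G v ∧ p.2 ∈ nbr G v)
        = nbr G v ×ˢ nbr G v := by
      ext p; simp
    rw [this, Finset.sum_const, Finset.card_product]
    have h' : (deg G v : ℝ) ≠ 0 := by exact_mod_cast h
    change ((deg G v * deg G v : ℕ)) • _ = _
    rw [nsmul_eq_mul]
    push_cast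
    field_simp

lemma sum_triWeight_mul_prod (G : SimpleGraph V) (g : V → V × V → ℝ) :
    ∑ c, triWeight G c * ∏ v, g v (c v) = ∏ v, ∑ p, choiceWeight G v p * g v p := by
  rw [Finset.prod_univ_sum, Fintype.piFinset_univ]
  simp only [triWeight_eq, Finset.prod_mul_distrib]

lemma sum_triWeight (G : SimpleGraph V) : ∑ c, triWeight G c = 1 := by
  have := sum_triWeight_mul_prod G (fun _ _ => 1)
  simpa [sum_choiceWeight] using this

/-- Expectation of `f` after one round of the triangulation process from `G`. -/
def roundExp (f : SimpleGraph V → ℝ) (G : SimpleGraph V) : ℝ :=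
  ∑ c, triWeight G c * f (triNext G c)

lemma markovOp_triStep : markovOp (triStep (V := V)) = roundExp := by
  funext f G
  simp only [markovOp, triStep, roundExp, Finset.sum_mul]
  rw [Finset.sum_comm]
  refine Finset.sum_congr rfl fun c _ => ?_
  simp [ite_mul]

omit [Fintype V] [DecidableEq V] in
lemma le_triNext (G : SimpleGraph V) (c : V → V × V) : G ≤ triNext G c := le_sup_left

/-- The probability that `B` does not hold after `T` rounds from `G`. -/
def failProb (T : ℕ) (B : SimpleGraph V → Prop) (G : SimpleGraph V) : ℝ :=
  roundExp^[T] (fun H => if B H then 0 else 1) G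

lemma roundExp_mono_on {I : SimpleGraph V → Prop} (hI : ∀ G H, I G → G ≤ H → I H)
    {f g : SimpleGraph V → ℝ} (h : ∀ G, I G → f G ≤ g G) {G : SimpleGraph V} (hG : I G) :
    roundExp f G ≤ roundExp g G :=
  Finset.sum_le_sum fun c _ =>
    mul_le_mul_of_nonneg_left (h _ (hI _ _ hG (le_triNext G c))) (triWeight_nonneg G c)

lemma iterate_mono_on {I : SimpleGraph V → Prop} (hI : ∀ G H, I G → G ≤ H → I H)
    {f g : SimpleGraph V → ℝ} (h : ∀ G, I G → f G ≤ g G) (T : ℕ) :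
    ∀ G, I G → roundExp^[T] f G ≤ roundExp^[T] g G := by
  induction T with
  | zero => simpa using h
  | succ T ih =>
    intro G hG
    rw [Function.iterate_succ_apply', Function.iterate_succ_apply']
    exact roundExp_mono_on hI ih hG

lemma iterate_mono {f g : SimpleGraph V → ℝ} (h : ∀ G, f G ≤ g G) (T : ℕ) (G : SimpleGraph V) :
    roundExp^[T] f G ≤ roundExp^[T] g G :=
  iterate_mono_on (I := fun _ => True) (fun _ _ _ _ => trivial) (fun G _ => h G) T G trivial

lemma iterate_add (f g : SimpleGraph V → ℝ) (T : ℕ) (G : SimpleGraph V) :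
    roundExp^[T] (fun H => f H + g H) G = roundExp^[T] f G + roundExp^[T] g G := by
  induction T generalizing G with
  | zero => simp
  | succ T ih =>
    simp only [Function.iterate_succ_apply']
    rw [show roundExp^[T] (fun H => f H + g H) =
      fun G => roundExp^[T] f G + roundExp^[T] g G from funext ih]
    simp [roundExp, mul_add, Finset.sum_add_distrib]

lemma iterate_const_mul (a : ℝ) (f : SimpleGraph V → ℝ) (T : ℕ) (G : SimpleGraph V) :
    roundExp^[T] (fun H => a * f H) G = a * roundExp^[T] f G := by
  induction T generalizing G with
  | zero => simp
  | succ T ih =>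
    simp only [Function.iterate_succ_apply']
    rw [show roundExp^[T] (fun H => a * f H) = fun G => a * roundExp^[T] f G from funext ih]
    simp only [roundExp, Finset.mul_sum]
    exact Finset.sum_congr rfl fun _ _ => by ring

lemma iterate_const (a : ℝ) (T : ℕ) (G : SimpleGraph V) :
    roundExp^[T] (fun _ => a) G = a := by
  induction T generalizing G with
  | zero => simp
  | succ T ih =>
    rw [Function.iterate_succ_apply', show roundExp^[T] (fun _ => a) = fun _ : SimpleGraph V => a
      from funext ih]
    simp [roundExp, ← Finset.sum_mul, sum_triWeight]

lemma iterate_le_of_drift {I : SimpleGraph V → Prop} (hI : ∀ G H, I G → G ≤ H → I H)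
    {f : SimpleGraph V → ℝ} {r : ℝ} (hr : 0 ≤ r)
    (h : ∀ G, I G → roundExp f G ≤ r * f G) (T : ℕ) :
    ∀ G, I G → roundExp^[T] f G ≤ r ^ T * f G := by
  induction T with
  | zero => simp
  | succ T ih =>
    intro G hG
    rw [Function.iterate_succ_apply]
    calc roundExp^[T] (roundExp f) G ≤ roundExp^[T] (fun H => r * f H) G :=
          iterate_mono_on hI h T G hG
      _ = r * roundExp^[T] f G := iterate_const_mul r f T G
      _ ≤ r * (r ^ T * f G) := mul_le_mul_of_nonneg_left (ih G hG) hr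
      _ = r ^ (T + 1) * f G := by ring

/-- From every graph satisfying `A`, after `T` rounds `B` fails with probability at most `ε`. -/
def Reaches (T : ℕ) (ε : ℝ) (A B : SimpleGraph V → Prop) : Prop :=
  ∀ G, A G → failProb T B G ≤ ε

lemma Reaches.trans {S T : ℕ} {ε ε' : ℝ} {A B C : SimpleGraph V → Prop} (hε' : 0 ≤ ε')
    (h₁ : Reaches S ε A B) (h₂ : Reaches T ε' B C) : Reaches (S + T) (ε + ε') A C := by
  intro G hG
  unfold failProb
  rw [Function.iterate_add_apply]
  calc roundExp^[S] (roundExp^[T] (fun H => if C H then 0 else 1)) G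
      ≤ roundExp^[S] (fun H => (if B H then 0 else 1) + ε') G := by
        refine iterate_mono (fun H => ?_) S G
        by_cases hB : B H
        · have := h₂ H hB
          unfold failProb at this
          simp only [hB, if_true]
          linarith
        · have : roundExp^[T] (fun H => if C H then 0 else 1) H ≤ 1 := by
            have := iterate_mono (f := fun H => if C H then 0 else 1) (g := fun _ => 1)
              (fun H => by split_ifs <;> norm_num) T H
            rwa [iterate_const] at this
          simp only [hB, if_false]
          linarith
    _ = failProb S B G + ε' := by rw [iterate_add, iterate_const]; rfl
    _ ≤ ε + ε' := by linarith [h₁ G hG]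

lemma failProb_mono {T : ℕ} {B C : SimpleGraph V → Prop} (h : ∀ G, B G → C G)
    (G : SimpleGraph V) : failProb T C G ≤ failProb T B G := by
  refine iterate_mono (fun H => ?_) T G
  by_cases hB : B H
  · simp [hB, h H hB]
  · simp only [hB, if_false]; split_ifs <;> norm_num

lemma Reaches.mono {T : ℕ} {ε ε' : ℝ} {A A' B B' : SimpleGraph V → Prop} (h : Reaches T ε A B)
    (hA : ∀ G, A' G → A G) (hB : ∀ G, B G → B' G) (hε : ε ≤ ε') : Reaches T ε' A' B' :=
  fun G hG => ((failProb_mono hB G).trans (h G (hA G hG))).trans hε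

lemma Reaches.forall {ι : Type} [Fintype ι] {T : ℕ} {ε : ℝ} {A : SimpleGraph V → Prop}
    {B : ι → SimpleGraph V → Prop} (h : ∀ i, Reaches T ε A (B i)) :
    Reaches T (Fintype.card ι * ε) A (fun G => ∀ i, B i G) := by
  have key : ∀ (s : Finset ι) (G : SimpleGraph V),
      failProb T (fun G => ∀ i ∈ s, B i G) G ≤ ∑ i ∈ s, failProb T (B i) G := by
    intro s
    induction s using Finset.induction_on with
    | empty =>
      intro G
      have := iterate_const 0 T G
      simp [failProb, this]
    | insert a s ha ih =>
      intro G
      rw [Finset.sum_insert ha]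
      refine le_trans ?_ (add_le_add_right (ih G) _)
      unfold failProb
      rw [← iterate_add]
      refine iterate_mono (fun H => ?_) T G
      have hins := Finset.forall_mem_insert a s (fun i => B i H)
      beta_reduce
      split_ifs <;> first
        | (norm_num; done)
        | exact absurd (hins.2 ⟨by assumption, by assumption⟩) (by assumption)
  intro G hG
  have := key Finset.univ G
  simp only [Finset.mem_univ, true_imp_iff] at this
  refine this.trans ((Finset.sum_le_sum fun i _ => h i G hG).trans ?_)
  simp

lemma reaches_self_of_monotone {A : SimpleGraph V → Prop} (hA : ∀ G H, A G → G ≤ H → A H)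
    (T : ℕ) : Reaches T 0 A A := by
  intro G hG
  have := iterate_mono_on hA (f := fun H => if A H then 0 else 1) (g := fun _ => 0)
    (fun H hH => by simp [hH]) T G hG
  rwa [iterate_const] at this

lemma Reaches.and_monotone {T : ℕ} {ε : ℝ} {A B I : SimpleGraph V → Prop} (h : Reaches T ε A B)
    (hI : ∀ G H, I G → G ≤ H → I H) :
    Reaches T ε (fun G => A G ∧ I G) (fun G => B G ∧ I G) := by
  rintro G ⟨hA, hG⟩
  refine le_trans ?_ (h G hA)
  exact iterate_mono_on hI (fun H hH => by simp [hH]) T G hG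

omit [Fintype V] [DecidableEq V] in
lemma triNext_adj {G : SimpleGraph V} {c : V → V × V} {x b y : V} (hxb : x ≠ b)
    (h : c y = (x, b)) : (triNext G c).Adj x b := by
  right
  rw [SimpleGraph.fromEdgeSet_adj]
  exact ⟨⟨y, by rw [h]⟩, hxb⟩

/-- The targets `b ∈ B` that some helper `y ∈ A` joins to `x` (in this order) under `c`. -/
def gained (x : V) (A B : Finset V) (c : V → V × V) : Finset V :=
  B.filter fun b => ∃ y ∈ A, c y = (x, b)

omit [Fintype V] in
lemma card_gained_le (x : V) (A B : Finset V) (c : V → V × V) :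
    (gained x A B c).card ≤ A.card := by
  refine (Finset.card_le_card (t := A.image fun y => (c y).2) ?_).trans Finset.card_image_le
  intro b hb
  obtain ⟨-, y, hy, h⟩ := Finset.mem_filter.1 hb
  exact Finset.mem_image.2 ⟨y, hy, by rw [h]⟩

lemma choiceWeight_eq {G : SimpleGraph V} {y x b : V} (hx : x ∈ nbr G y) :
    choiceWeight G y (x, b) = (if b ∈ nbr G y then 1 else 0) / (deg G y : ℝ) ^ 2 := by
  have h : deg G y ≠ 0 := Finset.card_ne_zero_of_mem hx
  unfold choiceWeight
  by_cases hb : b ∈ nbr G y <;> simp [h, hx, hb]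

lemma sum_triWeight_miss (G : SimpleGraph V) (x b : V) (A : Finset V) :
    ∑ c, triWeight G c * (if ∃ y ∈ A, c y = (x, b) then 0 else 1) =
      ∏ y ∈ A, (1 - choiceWeight G y (x, b)) := by
  have h1 : ∀ c : V → V × V, (if ∃ y ∈ A, c y = (x, b) then (0 : ℝ) else 1) =
      ∏ v, (if v ∈ A ∧ c v = (x, b) then 0 else 1) := by
    intro c
    split_ifs with h
    · obtain ⟨y, hy, h⟩ := h
      exact (Finset.prod_eq_zero (Finset.mem_univ y) (by simp [hy, h])).symm
    · push Not at h
      symm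
      refine Finset.prod_eq_one fun v _ => ?_
      rw [if_neg]
      rintro ⟨h1, h2⟩
      exact h v h1 h2
  simp only [h1]
  rw [sum_triWeight_mul_prod G (fun v p => if v ∈ A ∧ p = (x, b) then 0 else 1),
    ← Finset.prod_subset (Finset.subset_univ A)]
  · refine Finset.prod_congr rfl fun y hy => ?_
    have h2 : ∀ p, choiceWeight G y p * (if y ∈ A ∧ p = (x, b) then (0 : ℝ) else 1) =
        choiceWeight G y p - (if p = (x, b) then choiceWeight G y p else 0) := by
      intro p
      by_cases hp : p = (x, b) <;> simp [hp, hy]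
    simp only [h2, Finset.sum_sub_distrib, sum_choiceWeight]
    simp
  · intro y _ hy
    simp [hy, sum_choiceWeight]

lemma quarter_le_one_sub_exp {s : ℝ} (h0 : 0 ≤ s) (h3 : s ≤ 3) : s / 4 ≤ 1 - Real.exp (-s) := by
  have h1 : Real.exp (-s) ≤ 1 / (1 + s) := by
    rw [Real.exp_neg, ← one_div]
    exact one_div_le_one_div_of_le (by linarith) (by linarith [Real.add_one_le_exp s])
  have h2 : 1 / (1 + s) ≤ 1 - s / 4 := by
    rw [div_le_iff₀ (by linarith)]
    nlinarith
  linarith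

/-- Helpers of not too small degree, all adjacent to `x`, gain for `x` a constant fraction of
the targets they would gain if they never collided. -/
lemma expected_gained_ge {G : SimpleGraph V} {x : V} {A B : Finset V} {δ : ℝ} (hδ : 1 ≤ δ)
    (hdeg : ∀ y ∈ A, δ ≤ deg G y) (hA : ∀ y ∈ A, x ∈ nbr G y) (hcard : (A.card : ℝ) ≤ 3 * δ) :
    (∑ y ∈ A, ((nbr G y ∩ B).card : ℝ) / (deg G y : ℝ) ^ 2) / 4 ≤
      ∑ c, triWeight G c * ((gained x A B c).card : ℝ) := by
  have hswap : ∑ c, triWeight G c * ((gained x A B c).card : ℝ) =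
      ∑ b ∈ B, ∑ c, triWeight G c * (if ∃ y ∈ A, c y = (x, b) then 1 else 0) := by
    rw [Finset.sum_comm]
    refine Finset.sum_congr rfl fun c _ => ?_
    rw [← Finset.mul_sum]
    congr 1
    rw [gained, Finset.sum_boole]
  have hsum : ∑ y ∈ A, ((nbr G y ∩ B).card : ℝ) / (deg G y : ℝ) ^ 2 =
      ∑ b ∈ B, ∑ y ∈ A, choiceWeight G y (x, b) := by
    rw [Finset.sum_comm]
    refine Finset.sum_congr rfl fun y hy => ?_
    simp only [choiceWeight_eq (hA y hy)]
    rw [← Finset.sum_div, Finset.sum_boole, Finset.inter_comm, Finset.filter_mem_eq_inter]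
  rw [hswap, hsum, Finset.sum_div]
  refine Finset.sum_le_sum fun b _ => ?_
  set σ := ∑ y ∈ A, choiceWeight G y (x, b) with hσ
  have hp : ∀ y ∈ A, choiceWeight G y (x, b) ≤ 1 / δ ^ 2 := by
    intro y hy
    rw [choiceWeight_eq (hA y hy)]
    have h1 : (if b ∈ nbr G y then (1 : ℝ) else 0) ≤ 1 := by split_ifs <;> norm_num
    exact div_le_div₀ zero_le_one h1 (by positivity)
      (pow_le_pow_left₀ (by linarith) (hdeg y hy) 2)
  have hδ2 : 1 / δ ^ 2 ≤ 1 := by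
    rw [div_le_one (by positivity)]; nlinarith
  have hσ0 : 0 ≤ σ := Finset.sum_nonneg fun y _ => choiceWeight_nonneg G y _
  have hσ3 : σ ≤ 3 := by
    calc σ ≤ ∑ y ∈ A, 1 / δ ^ 2 := Finset.sum_le_sum hp
      _ = A.card * (1 / δ ^ 2) := by simp
      _ ≤ (3 * δ) * (1 / δ ^ 2) := by gcongr
      _ = 3 / δ := by field_simp
      _ ≤ 3 := by rw [div_le_iff₀ (by linarith)]; linarith
  have hexp : ∏ y ∈ A, (1 - choiceWeight G y (x, b)) ≤ Real.exp (-σ) := by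
    rw [hσ, ← Finset.sum_neg_distrib, Real.exp_sum]
    refine Finset.prod_le_prod (fun y hy => ?_) fun y _ => ?_
    · linarith [hp y hy]
    · linarith [Real.add_one_le_exp (-choiceWeight G y (x, b))]
  have hcompl : ∑ c, triWeight G c * (if ∃ y ∈ A, c y = (x, b) then 1 else 0) =
      1 - ∑ c, triWeight G c * (if ∃ y ∈ A, c y = (x, b) then 0 else 1) := by
    rw [eq_sub_iff_add_eq, ← Finset.sum_add_distrib]
    refine Eq.trans (Finset.sum_congr rfl fun c _ => ?_) (sum_triWeight G)
    split_ifs <;> ring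
  rw [hcompl, sum_triWeight_miss]
  linarith [quarter_le_one_sub_exp hσ0 hσ3]

/-- A multiplicative drift from a linear gain. -/
lemma roundExp_le_of_gain {G : SimpleGraph V} {f : SimpleGraph V → ℝ} {x : V} {A B : Finset V}
    {δ ρ q : ℝ} (hδ : 1 ≤ δ) (hdeg : ∀ y ∈ A, δ ≤ deg G y) (hA : ∀ y ∈ A, x ∈ nbr G y)
    (hcard : (A.card : ℝ) ≤ 3 * δ) (hq : 0 < q) (hf : 0 ≤ f G)
    (hgain : 4 * ρ * q ≤ ∑ y ∈ A, ((nbr G y ∩ B).card : ℝ) / (deg G y : ℝ) ^ 2)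
    (hstep : ∀ c, f (triNext G c) ≤ f G * (1 - (gained x A B c).card / q)) :
    roundExp f G ≤ (1 - ρ) * f G := by
  have h := expected_gained_ge (B := B) hδ hdeg hA hcard
  calc roundExp f G ≤ ∑ c, triWeight G c * (f G * (1 - (gained x A B c).card / q)) :=
        Finset.sum_le_sum fun c _ => mul_le_mul_of_nonneg_left (hstep c) (triWeight_nonneg G c)
    _ = f G * (∑ c, triWeight G c) -
        f G / q * ∑ c, triWeight G c * ((gained x A B c).card : ℝ) := by
        rw [Finset.mul_sum, Finset.mul_sum, ← Finset.sum_sub_distrib]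
        exact Finset.sum_congr rfl fun c _ => by ring
    _ ≤ f G - f G / q * (ρ * q) := by
        rw [sum_triWeight, mul_one]
        have : ρ * q ≤ ∑ c, triWeight G c * ((gained x A B c).card : ℝ) := by linarith
        have := mul_le_mul_of_nonneg_left this (div_nonneg hf hq.le)
        linarith
    _ = (1 - ρ) * f G := by field_simp

omit [DecidableEq V] in
lemma mem_nbr {G : SimpleGraph V} {v w : V} : w ∈ nbr G v ↔ G.Adj v w := by simp [nbr]

omit [DecidableEq V] in
lemma nbr_comm {G : SimpleGraph V} {v w : V} : w ∈ nbr G v ↔ v ∈ nbr G w := by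
  simp only [mem_nbr, G.adj_comm]

omit [DecidableEq V] in
lemma notMem_nbr_self {G : SimpleGraph V} {v : V} : v ∉ nbr G v := by simp [nbr]

omit [DecidableEq V] in
lemma nbr_mono {G H : SimpleGraph V} (h : G ≤ H) (v : V) : nbr G v ⊆ nbr H v := by
  intro w hw
  rw [mem_nbr] at *
  exact h hw

omit [DecidableEq V] in
lemma deg_mono {G H : SimpleGraph V} (h : G ≤ H) (v : V) : deg G v ≤ deg H v :=
  Finset.card_le_card (nbr_mono h v)

omit [DecidableEq V] in
lemma deg_le_card (G : SimpleGraph V) (v : V) : deg G v ≤ Fintype.card V := Finset.card_le_univ _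

lemma gained_subset_nbr {G : SimpleGraph V} {x : V} {A B : Finset V} (hx : x ∉ B)
    (c : V → V × V) : gained x A B c ⊆ nbr (triNext G c) x := by
  intro b hb
  obtain ⟨hbB, y, -, h⟩ := Finset.mem_filter.1 hb
  rw [mem_nbr]
  exact triNext_adj (fun h => hx (h ▸ hbB)) h

lemma sum_card_nbr_inter (G : SimpleGraph V) (A B : Finset V) :
    ∑ y ∈ A, (nbr G y ∩ B).card = ∑ b ∈ B, (nbr G b ∩ A).card := by
  have h : ∀ (v : V) (S : Finset V), (nbr G v ∩ S).card = ∑ w ∈ S, if G.Adj v w then 1 else 0 := by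
    intro v S
    rw [Finset.sum_boole, Finset.inter_comm, ← Finset.filter_mem_eq_inter]
    simp [mem_nbr]
  simp only [h]
  rw [Finset.sum_comm]
  simp only [G.adj_comm]

/-- `y` has at least `δ / 4` neighbors outside the reference set `N₀`. -/
def Strong (N₀ : Finset V) (δ : ℝ) (G : SimpleGraph V) (y : V) : Prop :=
  δ / 4 ≤ ((nbr G y \ N₀).card : ℝ)

/-- The neighbors of `u` that are strong with respect to `N₀`. -/
def strongNbr (N₀ : Finset V) (δ : ℝ) (G : SimpleGraph V) (u : V) : Finset V :=
  (nbr G u).filter (Strong N₀ δ G)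

lemma Strong.mono {N₀ : Finset V} {δ : ℝ} {G H : SimpleGraph V} {y : V} (h : Strong N₀ δ G y)
    (hGH : G ≤ H) : Strong N₀ δ H y := by
  refine le_trans h ?_
  exact_mod_cast Finset.card_le_card (Finset.sdiff_subset_sdiff (nbr_mono hGH y) subset_rfl)

lemma strongNbr_mono {N₀ : Finset V} {δ : ℝ} {G H : SimpleGraph V} (hGH : G ≤ H) (u : V) :
    strongNbr N₀ δ G u ⊆ strongNbr N₀ δ H u := by
  intro y hy
  obtain ⟨h1, h2⟩ := Finset.mem_filter.1 hy
  exact Finset.mem_filter.2 ⟨nbr_mono hGH u h1, h2.mono hGH⟩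

/-- The facts about the current graph that persist through a phase in which the neighborhood of
`u` was `N₀` (including `u`) at the start and all degrees were at least `δ`. -/
structure Phase (N₀ : Finset V) (δ : ℝ) (u : V) (G : SimpleGraph V) : Prop where
  one_le : 1 ≤ δ
  le_deg : ∀ v, δ ≤ deg G v
  subset : N₀ ⊆ insert u (nbr G u)
  card_ge : δ + 1 ≤ N₀.card

lemma Phase.mono {N₀ : Finset V} {δ : ℝ} {u : V} {G H : SimpleGraph V} (h : Phase N₀ δ u G)
    (hGH : G ≤ H) : Phase N₀ δ u H where
  one_le := h.one_le
  le_deg v := (h.le_deg v).trans (by exact_mod_cast deg_mono hGH v)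
  subset := h.subset.trans (Finset.insert_subset_insert _ (nbr_mono hGH u))
  card_ge := h.card_ge

/-- `u` has not yet gained a constant fraction of `δ` neighbors. -/
def Poor (δ : ℝ) (u : V) (G : SimpleGraph V) : Prop := (deg G u : ℝ) < 9 / 8 * δ

omit [DecidableEq V] in
lemma Poor.anti {δ : ℝ} {u : V} {G H : SimpleGraph V} (h : Poor δ u H) (hGH : G ≤ H) :
    Poor δ u G :=
  lt_of_le_of_lt (by exact_mod_cast deg_mono hGH u) h

/-- The vertices other than `u` that are not adjacent to `u`. -/
def outside (G : SimpleGraph V) (u : V) : Finset V := (insert u (nbr G u))ᶜ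

lemma card_insert_nbr (G : SimpleGraph V) (u : V) : (insert u (nbr G u)).card = deg G u + 1 := by
  rw [Finset.card_insert_of_notMem notMem_nbr_self]; rfl

lemma mem_outside {G : SimpleGraph V} {u v : V} : v ∈ outside G u ↔ v ≠ u ∧ v ∉ nbr G u := by
  simp [outside]

section PhaseLemmas

variable {N₀ : Finset V} {δ : ℝ} {u : V} {G : SimpleGraph V}

lemma Phase.strong_outside (h : Phase N₀ δ u G) (hp : Poor δ u G) {y : V} (hy : Strong N₀ δ G y) :
    δ / 8 ≤ ((nbr G y ∩ outside G u).card : ℝ) := by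
  have h1 : (nbr G y \ N₀).card ≤
      (nbr G y ∩ outside G u).card + (insert u (nbr G u) \ N₀).card := by
    refine (Finset.card_le_card ?_).trans (Finset.card_union_le _ _)
    intro z hz
    simp only [outside, Finset.mem_union, Finset.mem_inter, Finset.mem_sdiff,
      Finset.mem_compl] at *
    tauto
  have h2 := Finset.card_sdiff_add_card_eq_card h.subset
  rw [card_insert_nbr] at h2
  have h1' : ((nbr G y \ N₀).card : ℝ) ≤
      (nbr G y ∩ outside G u).card + (insert u (nbr G u) \ N₀).card := by exact_mod_cast h1
  have h2' : ((insert u (nbr G u) \ N₀).card : ℝ) + N₀.card = deg G u + 1 := by exact_mod_cast h2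
  have := h.card_ge
  unfold Poor at hp
  unfold Strong at hy
  linarith

lemma deg_le_outside_add {y : V} (hy : y ∈ nbr G u) :
    deg G y ≤ (nbr G y ∩ outside G u).card + deg G u := by
  have h1 : (nbr G y).card ≤
      (nbr G y ∩ outside G u).card + ((insert u (nbr G u)).erase y).card := by
    refine (Finset.card_le_card ?_).trans (Finset.card_union_le _ _)
    intro z hz
    have : z ≠ y := fun h => notMem_nbr_self (h ▸ hz)
    simp only [outside, Finset.mem_union, Finset.mem_inter, Finset.mem_compl,
      Finset.mem_erase]
    tauto
  rw [Finset.card_erase_of_mem (Finset.mem_insert_of_mem hy), card_insert_nbr] at h1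
  exact h1

lemma Phase.deg_lt_of_not_strong (h : Phase N₀ δ u G) (hp : Poor δ u G) {y : V}
    (hy : ¬ Strong N₀ δ G y) : (deg G y : ℝ) ≤ 4 * δ := by
  have h1 : (nbr G y).card ≤ (nbr G y \ N₀).card + N₀.card := by
    refine (Finset.card_le_card ?_).trans (Finset.card_union_le _ _)
    intro z hz
    simp only [Finset.mem_union, Finset.mem_sdiff]
    tauto
  have h2 := Finset.card_le_card h.subset
  rw [card_insert_nbr] at h2
  have h1' : (deg G y : ℝ) ≤ (nbr G y \ N₀).card + N₀.card := by exact_mod_cast h1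
  have h2' : (N₀.card : ℝ) ≤ deg G u + 1 := by exact_mod_cast h2
  have := h.one_le
  unfold Poor at hp
  unfold Strong at hy
  linarith

lemma Phase.card_nbr_inter_of_outside (h : Phase N₀ δ u G) {v : V} (hv : v ∉ nbr G u)
    (hs : ¬ Strong N₀ δ G v) : 3 / 4 * δ ≤ ((nbr G v ∩ nbr G u).card : ℝ) := by
  have h1 : (nbr G v).card ≤ (nbr G v \ N₀).card + (nbr G v ∩ nbr G u).card := by
    refine (Finset.card_le_card ?_).trans (Finset.card_union_le _ _)
    intro z hz
    by_cases hz0 : z ∈ N₀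
    · have hzu : z ≠ u := by
        rintro rfl
        exact hv (nbr_comm.1 hz)
      have := Finset.mem_of_mem_insert_of_ne (h.subset hz0) hzu
      simp only [Finset.mem_union, Finset.mem_inter]
      tauto
    · simp only [Finset.mem_union, Finset.mem_sdiff]
      tauto
  have h1' : (deg G v : ℝ) ≤ (nbr G v \ N₀).card + (nbr G v ∩ nbr G u).card := by
    exact_mod_cast h1
  have := h.le_deg v
  unfold Strong at hs
  linarith

lemma Phase.card_nbr_inter_of_nbr (h : Phase N₀ δ u G) {y : V}
    (hs : ¬ Strong N₀ δ G y) : 3 / 4 * δ - 1 ≤ ((nbr G y ∩ nbr G u).card : ℝ) := by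
  have h1 : (nbr G y).card ≤ (nbr G y \ N₀).card + (insert u (nbr G y ∩ nbr G u)).card := by
    refine (Finset.card_le_card ?_).trans (Finset.card_union_le _ _)
    intro z hz
    have := @h.subset z
    simp only [Finset.mem_union, Finset.mem_sdiff, Finset.mem_insert, Finset.mem_inter] at *
    tauto
  have h2 := Finset.card_insert_le u (nbr G y ∩ nbr G u)
  have h1' : (deg G y : ℝ) ≤ (nbr G y \ N₀).card + ((nbr G y ∩ nbr G u).card + 1) := by
    exact_mod_cast h1.trans (Nat.add_le_add_left h2 _)
  have := h.le_deg y
  unfold Strong at hs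
  linarith

lemma one_div_add_le {s z : ℝ} (hs : 0 < s) (hz : 0 ≤ z) (hzs : z ≤ s) :
    1 / (s + z) ≤ 1 / s * (1 - z / (2 * s)) := by
  have h : 1 / s * (1 - z / (2 * s)) - 1 / (s + z) = z * (s - z) / (2 * s ^ 2 * (s + z)) := by
    field_simp
    ring
  have : 0 ≤ z * (s - z) / (2 * s ^ 2 * (s + z)) :=
    div_nonneg (mul_nonneg hz (by linarith)) (by positivity)
  linarith

lemma inv_mul_le_div_sq {a d k n : ℝ} (hd : 0 < d) (hk : 0 < k) (hda : d ≤ k * a) (hdn : d ≤ n) :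
    1 / (k * n) ≤ a / d ^ 2 := by
  rw [div_le_div_iff₀ (by nlinarith) (by positivity)]
  nlinarith [mul_le_mul hda hdn hd.le (by nlinarith)]

/-- While `u` is poor, `escapePotential` measures how far `u` is from leaving this state, given
that it has a strong neighbor. -/
def escapePotential (N₀ : Finset V) (δ : ℝ) (u : V) (G : SimpleGraph V) : ℝ :=
  if Poor δ u G then (9 / 4 * δ - deg G u) / (strongNbr N₀ δ G u).card else 0

lemma escapePotential_step (hp : Poor δ u G)
    (hs : (strongNbr N₀ δ G u).Nonempty) {H : SimpleGraph V} {k l : ℝ} (hl : 0 ≤ l) (hkd : k ≤ deg G u)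
    (hd : deg G u + k ≤ deg H u) (hS : (strongNbr N₀ δ G u).card + l ≤ (strongNbr N₀ δ H u).card) :
    escapePotential N₀ δ u H ≤ (9 / 4 * δ - deg G u - k) / ((strongNbr N₀ δ G u).card + l) := by
  have hs' : (0 : ℝ) < (strongNbr N₀ δ G u).card := by exact_mod_cast hs.card_pos
  unfold escapePotential
  unfold Poor at *
  have hnum : 0 ≤ 9 / 4 * δ - deg G u - k := by linarith
  split_ifs with hH
  · exact div_le_div₀ hnum (by linarith) (by linarith) hS
  · positivity

lemma Phase.drift_escapePotential (h : Phase N₀ δ u G)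
    (hs : (strongNbr N₀ δ G u).Nonempty) :
    roundExp (escapePotential N₀ δ u) G ≤
      (1 - 1 / (5000 * Fintype.card V)) * escapePotential N₀ δ u G := by
  by_cases hp : Poor δ u G
  swap
  · have h0 : ∀ H, G ≤ H → escapePotential N₀ δ u H = 0 := fun H hGH =>
      if_neg fun hH => hp (hH.anti hGH)
    simp [roundExp, h0 _ (le_triNext G _), h0 G le_rfl]
  have hp' : (deg G u : ℝ) < 9 / 8 * δ := hp
  have hδ := h.one_le
  have hfG : escapePotential N₀ δ u G = (9 / 4 * δ - deg G u) / (strongNbr N₀ δ G u).card :=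
    if_pos hp
  set S := strongNbr N₀ δ G u with hS
  have hSpos : (0 : ℝ) < S.card := by exact_mod_cast hs.card_pos
  have hf0 : 0 ≤ escapePotential N₀ δ u G := by
    rw [hfG]
    exact div_nonneg (by linarith) hSpos.le
  have hSN : S ⊆ nbr G u := Finset.filter_subset _ _
  have hn : (deg G u : ℝ) ≤ Fintype.card V := by exact_mod_cast deg_le_card G u
  have hδn : δ ≤ Fintype.card V := (h.le_deg u).trans hn
  set n : ℝ := ((Fintype.card V : ℕ) : ℝ) with hn_def
  have hn0 : 0 < n := by linarith
  have hcardN : ∀ A ⊆ nbr G u, (A.card : ℝ) ≤ deg G u := fun A hA => by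
    exact_mod_cast Finset.card_le_card hA
  have hmemN : ∀ A ⊆ nbr G u, ∀ y ∈ A, u ∈ nbr G y := fun A hA y hy => nbr_comm.1 (hA hy)
  have hmonoS : ∀ c, S.card + (0 : ℝ) ≤ (strongNbr N₀ δ (triNext G c) u).card := fun c => by
    rw [add_zero]
    exact_mod_cast Finset.card_le_card (strongNbr_mono (le_triNext G c) u)
  have hstepD : ∀ A ⊆ nbr G u, ∀ B ⊆ outside G u, ∀ c, escapePotential N₀ δ u (triNext G c) ≤
      escapePotential N₀ δ u G * (1 - (gained u A B c).card / (9 / 4 * δ - deg G u)) := by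
    intro A hA B hB c
    have huB : u ∉ B := fun hu => (mem_outside.1 (hB hu)).1 rfl
    have hdisj : Disjoint (nbr G u) (gained u A B c) := by
      rw [Finset.disjoint_right]
      intro b hb
      exact (mem_outside.1 (hB (Finset.filter_subset _ _ hb))).2
    have hdeg : deg G u + (gained u A B c).card ≤ deg (triNext G c) u := by
      unfold deg
      rw [← Finset.card_union_of_disjoint hdisj]
      exact Finset.card_le_card
        (Finset.union_subset (nbr_mono (le_triNext G c) u) (gained_subset_nbr huB c))
    have := escapePotential_step hp hs (k := (gained u A B c).card) (l := 0) le_rfl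
      (by exact_mod_cast (card_gained_le u A B c).trans (Finset.card_le_card hA))
      (by exact_mod_cast hdeg) (hmonoS c)
    refine this.trans (le_of_eq ?_)
    have h1 : 9 / 4 * δ - deg G u ≠ 0 := by linarith
    rw [hfG, ← hS]
    generalize 9 / 4 * δ - (deg G u : ℝ) = K at h1 ⊢
    field_simp
    ring
  by_cases hbig : δ / 4 ≤ S.card
  · -- many strong neighbors
    refine roundExp_le_of_gain (x := u) (A := S) (B := outside G u) hδ (fun y _ => h.le_deg y)
      (hmemN S hSN) (by linarith [hcardN S hSN]) (q := 9 / 4 * δ - deg G u) (by linarith) hf0 ?_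
      (hstepD S hSN _ subset_rfl)
    have hterm : ∀ y ∈ S, 1 / (10 * n) ≤
        ((nbr G y ∩ outside G u).card : ℝ) / (deg G y : ℝ) ^ 2 := by
      intro y hy
      have h1 := h.strong_outside hp (Finset.mem_filter.1 hy).2
      have h2 : (deg G y : ℝ) ≤ (nbr G y ∩ outside G u).card + deg G u := by
        exact_mod_cast deg_le_outside_add (hSN hy)
      exact inv_mul_le_div_sq (by linarith [h.le_deg y]) (by norm_num) (by linarith)
        (Nat.cast_le.2 (deg_le_card G y))
    refine le_trans ?_ (Finset.sum_le_sum hterm)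
    rw [Finset.sum_const, nsmul_eq_mul, mul_one_div, mul_one_div, div_mul_eq_mul_div,
      div_le_div_iff₀ (by positivity) (by positivity)]
    nlinarith [h.le_deg u]
  push Not at hbig
  set W := (outside G u).filter (fun v => ¬ Strong N₀ δ G v) with hW
  by_cases hmany : δ / 16 ≤ W.card
  · -- many weak vertices outside, each with many common neighbors with `u`
    have hA : nbr G u \ S ⊆ nbr G u := Finset.sdiff_subset
    refine roundExp_le_of_gain (x := u) (A := nbr G u \ S) (B := W) hδ
      (fun y _ => h.le_deg y) (hmemN _ hA) (by linarith [hcardN _ hA]) (q := 9 / 4 * δ - deg G u)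
      (by linarith) hf0 ?_ (hstepD _ hA _ (Finset.filter_subset _ _))
    have hterm : ∀ y ∈ nbr G u \ S, (nbr G y ∩ W).card * (1 / (16 * δ ^ 2)) ≤
        ((nbr G y ∩ W).card : ℝ) / (deg G y : ℝ) ^ 2 := by
      intro y hy
      rw [Finset.mem_sdiff] at hy
      have hns : ¬ Strong N₀ δ G y := fun hst => hy.2 (Finset.mem_filter.2 ⟨hy.1, hst⟩)
      have h1 := h.deg_lt_of_not_strong hp hns
      have h2 := h.le_deg y
      rw [mul_one_div]
      refine div_le_div_of_nonneg_left (by positivity) (by nlinarith) ?_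
      calc (deg G y : ℝ) ^ 2 ≤ (4 * δ) ^ 2 := pow_le_pow_left₀ (by linarith) h1 2
        _ = 16 * δ ^ 2 := by ring
    refine le_trans ?_ (Finset.sum_le_sum hterm)
    rw [← Finset.sum_mul]
    have hdc : ∑ y ∈ nbr G u \ S, ((nbr G y ∩ W).card : ℝ) =
        ∑ b ∈ W, ((nbr G b ∩ (nbr G u \ S)).card : ℝ) := by
      exact_mod_cast sum_card_nbr_inter G (nbr G u \ S) W
    have hb : ∀ b ∈ W, δ / 2 ≤ ((nbr G b ∩ (nbr G u \ S)).card : ℝ) := by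
      intro b hb
      obtain ⟨hbO, hbS⟩ := Finset.mem_filter.1 hb
      have h1 := h.card_nbr_inter_of_outside (mem_outside.1 hbO).2 hbS
      have h2 : (nbr G b ∩ nbr G u).card ≤ (nbr G b ∩ (nbr G u \ S)).card + S.card := by
        refine (Finset.card_le_card ?_).trans (Finset.card_union_le _ _)
        intro z hz
        simp only [Finset.mem_union, Finset.mem_inter, Finset.mem_sdiff] at *
        tauto
      have h2' : ((nbr G b ∩ nbr G u).card : ℝ) ≤ (nbr G b ∩ (nbr G u \ S)).card + S.card := by
        exact_mod_cast h2
      linarith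
    have hsum : δ / 16 * (δ / 2) ≤ ∑ b ∈ W, ((nbr G b ∩ (nbr G u \ S)).card : ℝ) := by
      refine le_trans ?_ (Finset.sum_le_sum hb)
      rw [Finset.sum_const, nsmul_eq_mul]
      gcongr
    rw [hdc]
    calc 4 * (1 / (5000 * n)) * (9 / 4 * δ - deg G u) ≤ 1 / 512 := by
          rw [mul_one_div, div_mul_eq_mul_div, div_le_div_iff₀ (by positivity) (by norm_num)]
          nlinarith [h.le_deg u]
      _ = δ / 16 * (δ / 2) * (1 / (16 * δ ^ 2)) := by field_simp; norm_num
      _ ≤ _ := by gcongr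
  · -- strong neighbors mostly see strong vertices
    push Not at hmany
    set B := (outside G u).filter (Strong N₀ δ G) with hB
    have huB : u ∉ B := fun hu => (mem_outside.1 (Finset.mem_filter.1 hu).1).1 rfl
    refine roundExp_le_of_gain (x := u) (A := S) (B := B) hδ (fun y _ => h.le_deg y)
      (hmemN S hSN) (by linarith [hcardN S hSN]) (q := 2 * S.card) (by positivity) hf0 ?_ ?_
    · have hterm : ∀ y ∈ S, 1 / (20 * n) ≤ ((nbr G y ∩ B).card : ℝ) / (deg G y : ℝ) ^ 2 := by
        intro y hy
        have h1 := h.strong_outside hp (Finset.mem_filter.1 hy).2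
        have h2 : (deg G y : ℝ) ≤ (nbr G y ∩ outside G u).card + deg G u := by
          exact_mod_cast deg_le_outside_add (hSN hy)
        have h3 : (nbr G y ∩ outside G u).card ≤ (nbr G y ∩ B).card + W.card := by
          refine (Finset.card_le_card ?_).trans (Finset.card_union_le _ _)
          intro z hz
          simp only [hB, hW, Finset.mem_union, Finset.mem_inter, Finset.mem_filter] at *
          tauto
        have h3' : ((nbr G y ∩ outside G u).card : ℝ) ≤ (nbr G y ∩ B).card + W.card := by
          exact_mod_cast h3
        exact inv_mul_le_div_sq (by linarith [h.le_deg y]) (by norm_num) (by linarith)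
          (Nat.cast_le.2 (deg_le_card G y))
      refine le_trans ?_ (Finset.sum_le_sum hterm)
      rw [Finset.sum_const, nsmul_eq_mul, mul_one_div, mul_one_div, div_mul_eq_mul_div,
        div_le_div_iff₀ (by positivity) (by positivity)]
      nlinarith [mul_pos hSpos hn0]
    · intro c
      have hdisj : Disjoint S (gained u S B c) := by
        rw [Finset.disjoint_right]
        intro b hb hbS
        exact (mem_outside.1 (Finset.mem_filter.1 (Finset.filter_subset _ _ hb)).1).2 (hSN hbS)
      have hcard : S.card + (gained u S B c).card ≤ (strongNbr N₀ δ (triNext G c) u).card := by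
        rw [← Finset.card_union_of_disjoint hdisj]
        refine Finset.card_le_card (Finset.union_subset (strongNbr_mono (le_triNext G c) u) ?_)
        intro b hb
        refine Finset.mem_filter.2 ⟨gained_subset_nbr huB c hb, ?_⟩
        exact (Finset.mem_filter.1 (Finset.filter_subset _ _ hb)).2.mono (le_triNext G c)
      have := escapePotential_step hp hs (H := triNext G c) (k := 0)
        (l := (gained u S B c).card) (by positivity) (by positivity)
        (by rw [add_zero]; exact_mod_cast deg_mono (le_triNext G c) u) (by exact_mod_cast hcard)
      refine this.trans ?_
      have hZ : ((gained u S B c).card : ℝ) ≤ S.card := by exact_mod_cast card_gained_le u S B c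
      have hK : 0 ≤ 9 / 4 * δ - deg G u := by linarith
      rw [hfG, ← hS, sub_zero, div_eq_mul_one_div, div_eq_mul_one_div (9 / 4 * δ - (deg G u : ℝ)),
        mul_assoc]
      exact mul_le_mul_of_nonneg_left (one_div_add_le hSpos (by positivity) hZ) hK

/-- While `u` is poor, without strong neighbors and not adjacent to `v`, the reciprocal of the
number of common neighbors of `u` and `v`. -/
def closePotential (N₀ : Finset V) (δ : ℝ) (u v : V) (G : SimpleGraph V) : ℝ :=
  if Poor δ u G ∧ strongNbr N₀ δ G u = ∅ ∧ v ∉ nbr G u then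
    1 / ((nbr G u ∩ nbr G v).card : ℝ) else 0

lemma closePotential_le {v : V} {H : SimpleGraph V} {a : ℝ} (ha : 0 < a)
    (h : a ≤ ((nbr H u ∩ nbr H v).card : ℝ)) : closePotential N₀ δ u v H ≤ 1 / a := by
  unfold closePotential
  split_ifs
  · exact one_div_le_one_div_of_le ha h
  · positivity

lemma Phase.drift_closePotential (h : Phase N₀ δ u G) {v : V} (hvu : v ≠ u)
    (hc : (nbr G u ∩ nbr G v).Nonempty) :
    roundExp (closePotential N₀ δ u v) G ≤
      (1 - 1 / (5000 * Fintype.card V)) * closePotential N₀ δ u v G := by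
  by_cases hcond : Poor δ u G ∧ strongNbr N₀ δ G u = ∅ ∧ v ∉ nbr G u
  swap
  · have h0 : ∀ H, G ≤ H → closePotential N₀ δ u v H = 0 := fun H hGH =>
      if_neg fun ⟨h1, h2, h3⟩ => hcond ⟨h1.anti hGH,
        Finset.subset_empty.1 (h2 ▸ strongNbr_mono hGH u), fun hv => h3 (nbr_mono hGH u hv)⟩
    simp [roundExp, h0 _ (le_triNext G _), h0 G le_rfl]
  have hfG : closePotential N₀ δ u v G = 1 / ((nbr G u ∩ nbr G v).card : ℝ) := if_pos hcond
  obtain ⟨hp, hS, hv⟩ := hcond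
  have hp' : (deg G u : ℝ) < 9 / 8 * δ := hp
  have hδ := h.one_le
  set A := nbr G u ∩ nbr G v with hA
  have hm : (0 : ℝ) < A.card := by exact_mod_cast hc.card_pos
  have hAu : A ⊆ nbr G u := Finset.inter_subset_left
  have hweak : ∀ y ∈ A, ¬ Strong N₀ δ G y := fun y hy hst => by
    have : y ∈ strongNbr N₀ δ G u := Finset.mem_filter.2 ⟨hAu hy, hst⟩
    simp [hS] at this
  have hδ4 : 4 < δ := by
    obtain ⟨w, hw⟩ := hc
    have h1 : v ∈ nbr G w \ N₀ := by
      refine Finset.mem_sdiff.2 ⟨nbr_comm.1 (Finset.mem_inter.1 hw).2, fun hv0 => hv ?_⟩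
      exact Finset.mem_of_mem_insert_of_ne (h.subset hv0) hvu
    have h2 : (1 : ℝ) ≤ ((nbr G w \ N₀).card : ℝ) := by
      exact_mod_cast Finset.card_pos.2 ⟨v, h1⟩
    have h3 := hweak w hw
    unfold Strong at h3
    linarith
  have hf0 : 0 ≤ closePotential N₀ δ u v G := by rw [hfG]; positivity
  have hn : (deg G u : ℝ) ≤ Fintype.card V := Nat.cast_le.2 (deg_le_card G u)
  have hδn : δ ≤ Fintype.card V := (h.le_deg u).trans hn
  set n : ℝ := ((Fintype.card V : ℕ) : ℝ) with hn_def
  have hn0 : 0 < n := by linarith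
  have hAcard : (A.card : ℝ) ≤ 3 * δ := by
    have : (A.card : ℝ) ≤ deg G u := Nat.cast_le.2 (Finset.card_le_card hAu)
    linarith
  by_cases hfew : (A.card : ℝ) ≤ δ / 4
  · have hvB : v ∉ nbr G u \ nbr G v := fun hmem => hv (Finset.mem_sdiff.1 hmem).1
    refine roundExp_le_of_gain (x := v) (A := A) (B := nbr G u \ nbr G v) hδ
      (fun y _ => h.le_deg y) (fun y hy => nbr_comm.1 (Finset.mem_inter.1 hy).2) hAcard
      (q := 2 * A.card) (by positivity) hf0 ?_ ?_
    · have hterm : ∀ y ∈ A, 1 / (16 * n) ≤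
          ((nbr G y ∩ (nbr G u \ nbr G v)).card : ℝ) / (deg G y : ℝ) ^ 2 := by
        intro y hy
        have h1 := h.card_nbr_inter_of_nbr (hweak y hy)
        have h2 : (nbr G y ∩ nbr G u).card ≤
            (nbr G y ∩ (nbr G u \ nbr G v)).card + A.card := by
          refine (Finset.card_le_card ?_).trans (Finset.card_union_le _ _)
          intro z hz
          simp only [hA, Finset.mem_union, Finset.mem_inter, Finset.mem_sdiff] at *
          tauto
        have h2' : ((nbr G y ∩ nbr G u).card : ℝ) ≤
            (nbr G y ∩ (nbr G u \ nbr G v)).card + A.card := by exact_mod_cast h2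
        have h3 := h.deg_lt_of_not_strong hp (hweak y hy)
        exact inv_mul_le_div_sq (by linarith [h.le_deg y]) (by norm_num) (by linarith)
          (Nat.cast_le.2 (deg_le_card G y))
      refine le_trans ?_ (Finset.sum_le_sum hterm)
      rw [Finset.sum_const, nsmul_eq_mul, mul_one_div, mul_one_div, div_mul_eq_mul_div,
        div_le_div_iff₀ (by positivity) (by positivity)]
      nlinarith [mul_pos hm hn0]
    · intro c
      have hdisj : Disjoint A (gained v A (nbr G u \ nbr G v) c) := by
        rw [Finset.disjoint_right]
        intro b hb hbA
        exact (Finset.mem_sdiff.1 (Finset.filter_subset _ _ hb)).2 (Finset.mem_inter.1 hbA).2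
      have hcard : A.card + (gained v A (nbr G u \ nbr G v) c).card ≤
          (nbr (triNext G c) u ∩ nbr (triNext G c) v).card := by
        rw [← Finset.card_union_of_disjoint hdisj]
        refine Finset.card_le_card (Finset.union_subset ?_ ?_)
        · exact Finset.inter_subset_inter (nbr_mono (le_triNext G c) u)
            (nbr_mono (le_triNext G c) v)
        · intro b hb
          refine Finset.mem_inter.2 ⟨?_, gained_subset_nbr hvB c hb⟩
          exact nbr_mono (le_triNext G c) u
            (Finset.mem_sdiff.1 (Finset.filter_subset _ _ hb)).1
      refine (closePotential_le (a := A.card + (gained v A (nbr G u \ nbr G v) c).card)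
        (by positivity) (by exact_mod_cast hcard)).trans ?_
      rw [hfG]
      exact one_div_add_le hm (by positivity) (Nat.cast_le.2 (card_gained_le _ _ _ _))
  · push Not at hfew
    refine roundExp_le_of_gain (x := u) (A := A) (B := {v}) hδ
      (fun y _ => h.le_deg y) (fun y hy => nbr_comm.1 (hAu hy)) hAcard
      (q := 1) one_pos hf0 ?_ ?_
    · have hterm : ∀ y ∈ A, 1 / (16 * δ ^ 2) ≤
          ((nbr G y ∩ {v}).card : ℝ) / (deg G y : ℝ) ^ 2 := by
        intro y hy
        have h1 : nbr G y ∩ {v} = {v} :=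
          Finset.inter_eq_right.2 (Finset.singleton_subset_iff.2
            (nbr_comm.1 (Finset.mem_inter.1 hy).2))
        have h2 := h.deg_lt_of_not_strong hp (hweak y hy)
        have h3 := h.le_deg y
        rw [h1, Finset.card_singleton, Nat.cast_one]
        refine one_div_le_one_div_of_le (by nlinarith) ?_
        calc (deg G y : ℝ) ^ 2 ≤ (4 * δ) ^ 2 := pow_le_pow_left₀ (by linarith) h2 2
          _ = 16 * δ ^ 2 := by ring
      refine le_trans ?_ (Finset.sum_le_sum hterm)
      rw [Finset.sum_const, nsmul_eq_mul]
      calc 4 * (1 / (5000 * n)) * 1 ≤ 1 / (64 * δ) := by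
            rw [mul_one, mul_one_div, div_le_div_iff₀ (by positivity) (by positivity)]
            linarith
        _ = δ / 4 * (1 / (16 * δ ^ 2)) := by field_simp; norm_num
        _ ≤ A.card * (1 / (16 * δ ^ 2)) := by gcongr
    · intro c
      rcases (gained u A {v} c).eq_empty_or_nonempty with he | ⟨b, hb⟩
      · rw [he, hfG]
        simp only [Finset.card_empty, Nat.cast_zero, zero_div, sub_zero, mul_one]
        refine closePotential_le hm (Nat.cast_le.2 (Finset.card_le_card ?_))
        exact Finset.inter_subset_inter (nbr_mono (le_triNext G c) u)
          (nbr_mono (le_triNext G c) v)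
      · have hbv : b = v := Finset.mem_singleton.1 (Finset.filter_subset _ _ hb)
        have hadj : v ∈ nbr (triNext G c) u :=
          hbv ▸ gained_subset_nbr (by simpa using hvu.symm) c hb
        have h0 : closePotential N₀ δ u v (triNext G c) = 0 := if_neg fun hh => hh.2.2 hadj
        have h1 : ((gained u A {v} c).card : ℝ) ≤ 1 := by
          exact_mod_cast (Finset.card_le_card (Finset.filter_subset _ _)).trans
            (Finset.card_singleton v).le
        rw [h0]
        exact mul_nonneg hf0 (by rw [div_one]; linarith)

end PhaseLemmas

lemma failProb_le_of_drift {I B : SimpleGraph V → Prop} (hI : ∀ G H, I G → G ≤ H → I H)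
    {f : SimpleGraph V → ℝ} {r a b : ℝ} (hr : 0 ≤ r) (ha : 0 < a)
    (hdrift : ∀ G, I G → roundExp f G ≤ r * f G) (hf : ∀ G, I G → 0 ≤ f G)
    (hfa : ∀ G, I G → ¬ B G → a ≤ f G) (hfb : ∀ G, I G → f G ≤ b) (T : ℕ) :
    Reaches T (b / a * r ^ T) I B := by
  intro G hG
  calc failProb T B G ≤ roundExp^[T] (fun H => 1 / a * f H) G := by
        refine iterate_mono_on hI (fun H hH => ?_) T G hG
        by_cases hB : B H
        · simp only [hB, if_true]
          exact mul_nonneg (by positivity) (hf H hH)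
        · simp only [hB, if_false]
          rw [one_div_mul_eq_div, le_div_iff₀ ha, one_mul]
          exact hfa H hH hB
    _ = 1 / a * roundExp^[T] f G := iterate_const_mul _ _ _ _
    _ ≤ 1 / a * (r ^ T * b) := by
        gcongr
        exact (iterate_le_of_drift hI hr hdrift T G hG).trans
          (mul_le_mul_of_nonneg_left (hfb G hG) (by positivity))
    _ = b / a * r ^ T := by ring

/-- The factor by which the potentials shrink in each round on `n` vertices. -/
def decay (n : ℕ) : ℝ := 1 - 1 / (5000 * n)

lemma decay_nonneg (n : ℕ) : 0 ≤ decay n := by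
  unfold decay
  rcases Nat.eq_zero_or_pos n with rfl | hn
  · simp
  · have : (1 : ℝ) ≤ n := by exact_mod_cast hn
    rw [sub_nonneg, div_le_one (by positivity)]
    linarith

lemma reaches_not_poor [Nonempty V] (N₀ : Finset V) (δ : ℝ) (u : V) (T : ℕ) :
    Reaches T (2 * Fintype.card V * decay (Fintype.card V) ^ T)
      (fun G => Phase N₀ δ u G ∧ (strongNbr N₀ δ G u).Nonempty) (fun G => ¬ Poor δ u G) := by
  rintro G ⟨hG, hGs⟩
  have hδ := hG.one_le
  have hn : (0 : ℝ) < Fintype.card V := by exact_mod_cast Fintype.card_pos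
  have := failProb_le_of_drift
    (I := fun G => Phase N₀ δ u G ∧ (strongNbr N₀ δ G u).Nonempty)
    (B := fun G => ¬ Poor δ u G) (f := escapePotential N₀ δ u)
    (a := 9 / 8 * δ / Fintype.card V) (b := 9 / 4 * δ)
    (fun G H h hGH => ⟨h.1.mono hGH, h.2.mono (strongNbr_mono hGH u)⟩)
    (decay_nonneg (Fintype.card V)) (by positivity)
    (fun G h => h.1.drift_escapePotential h.2)
    (fun G h => by
      unfold escapePotential
      split_ifs with hp
      · exact div_nonneg (by unfold Poor at hp; linarith) (by positivity)
      · exact le_rfl)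
    (fun G h hp => by
      rw [not_not] at hp
      have hs : (0 : ℝ) < (strongNbr N₀ δ G u).card := by exact_mod_cast h.2.card_pos
      rw [escapePotential, if_pos hp]
      unfold Poor at hp
      exact div_le_div₀ (by linarith) (by linarith) hs (by exact_mod_cast Finset.card_le_univ _))
    (fun G h => by
      have hs : (1 : ℝ) ≤ (strongNbr N₀ δ G u).card := by exact_mod_cast h.2.card_pos
      unfold escapePotential
      split_ifs with hp
      · unfold Poor at hp
        rw [div_le_iff₀ (by linarith)]
        have : (0 : ℝ) ≤ deg G u := by positivity
        nlinarith
      · positivity) T G ⟨hG, hGs⟩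
  refine this.trans (le_of_eq ?_)
  congr 1
  field_simp
  norm_num

lemma reaches_adj [Nonempty V] (N₀ : Finset V) (δ : ℝ) {u v : V} (hvu : v ≠ u) (T : ℕ) :
    Reaches T (Fintype.card V * decay (Fintype.card V) ^ T)
      (fun G => Phase N₀ δ u G ∧ (nbr G u ∩ nbr G v).Nonempty)
      (fun G => ¬ Poor δ u G ∨ (strongNbr N₀ δ G u).Nonempty ∨ v ∈ nbr G u) := by
  have hn : (0 : ℝ) < Fintype.card V := by exact_mod_cast Fintype.card_pos
  have := failProb_le_of_drift
    (I := fun G => Phase N₀ δ u G ∧ (nbr G u ∩ nbr G v).Nonempty)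
    (B := fun G => ¬ Poor δ u G ∨ (strongNbr N₀ δ G u).Nonempty ∨ v ∈ nbr G u)
    (f := closePotential N₀ δ u v) (a := 1 / Fintype.card V) (b := 1)
    (fun G H h hGH => ⟨h.1.mono hGH, h.2.mono
      (Finset.inter_subset_inter (nbr_mono hGH u) (nbr_mono hGH v))⟩)
    (decay_nonneg (Fintype.card V)) (by positivity)
    (fun G h => h.1.drift_closePotential hvu h.2)
    (fun G h => by unfold closePotential; split_ifs <;> positivity)
    (fun G h hB => by
      push Not at hB
      have hs : (0 : ℝ) < (nbr G u ∩ nbr G v).card := by exact_mod_cast h.2.card_pos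
      rw [closePotential, if_pos (by simpa using hB)]
      exact one_div_le_one_div_of_le hs (by exact_mod_cast Finset.card_le_univ _))
    (fun G h => by
      have := closePotential_le (N₀ := N₀) (δ := δ) (u := u) (v := v) (H := G) one_pos
        (by exact_mod_cast h.2.card_pos)
      simpa using this) T
  simpa using this

section SingleVertex

variable (N₀ : Finset V) (δ : ℝ) (u : V)

/-- The vertex `v` has joined the closed neighborhood of `u`, unless `u` has already made progress
or acquired a strong neighbor. -/
def Joined (v : V) (H : SimpleGraph V) : Prop :=
  Phase N₀ δ u H ∧
    (¬ Poor δ u H ∨ (strongNbr N₀ δ H u).Nonempty ∨ v = u ∨ v ∈ nbr H u)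

/-- The vertex `v` is at distance at most two from `u`. -/
def Close (H : SimpleGraph V) (v : V) : Prop :=
  v = u ∨ v ∈ nbr H u ∨ (nbr H u ∩ nbr H v).Nonempty

variable {N₀ δ u}

lemma Joined.mono {v : V} {G H : SimpleGraph V} (h : Joined N₀ δ u v G) (hGH : G ≤ H) :
    Joined N₀ δ u v H := by
  refine ⟨h.1.mono hGH, ?_⟩
  rcases h.2 with h | h | h | h
  · exact Or.inl fun hp => h (hp.anti hGH)
  · exact Or.inr (Or.inl (h.mono (strongNbr_mono hGH u)))
  · exact Or.inr (Or.inr (Or.inl h))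
  · exact Or.inr (Or.inr (Or.inr (nbr_mono hGH u h)))

lemma decay_pow_nonneg (n T : ℕ) : 0 ≤ n * decay n ^ T :=
  mul_nonneg n.cast_nonneg (pow_nonneg (decay_nonneg n) T)

lemma reaches_joined [Nonempty V] (v : V) (T : ℕ) :
    Reaches T (Fintype.card V * decay (Fintype.card V) ^ T)
      (fun G => Phase N₀ δ u G ∧
        (¬ Poor δ u G ∨ (strongNbr N₀ δ G u).Nonempty ∨ Close u G v))
      (Joined N₀ δ u v) := by
  rintro G ⟨hP, hG⟩
  by_cases hJ : Joined N₀ δ u v G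
  · exact (reaches_self_of_monotone (fun _ _ h hGH => Joined.mono h hGH) T G hJ).trans
      (decay_pow_nonneg _ T)
  · have hJ' := fun h => hJ ⟨hP, h⟩
    have hvu : v ≠ u := fun h => hJ' (Or.inr (Or.inr (Or.inl h)))
    have hc : (nbr G u ∩ nbr G v).Nonempty := by
      unfold Close at hG
      tauto
    refine ((reaches_adj N₀ δ hvu T).and_monotone (I := Phase N₀ δ u)
      (fun _ _ h hGH => h.mono hGH)).mono (A' := fun H => H = G) ?_ ?_ le_rfl G rfl
    · rintro _ rfl
      exact ⟨⟨hP, hc⟩, hP⟩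
    · rintro H ⟨h, hH⟩
      exact ⟨hH, by tauto⟩

/-- Either `u` has made progress, or it has a strong neighbor, or it is adjacent to everything. -/
def Prepared (N₀ : Finset V) (δ : ℝ) (u : V) (H : SimpleGraph V) : Prop :=
  ∀ v, Joined N₀ δ u v H

lemma Prepared.of_not_poor_or {H : SimpleGraph V} (hP : Phase N₀ δ u H)
    (h : ¬ Poor δ u H ∨ (strongNbr N₀ δ H u).Nonempty) : Prepared N₀ δ u H :=
  fun _ => ⟨hP, h.elim Or.inl fun h => Or.inr (Or.inl h)⟩

lemma reaches_prepared_of_close [Nonempty V] {G : SimpleGraph V} (hP : Phase N₀ δ u G)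
    (hG : ∀ v, Close u G v) (T : ℕ) :
    Reaches T (Fintype.card V * (Fintype.card V * decay (Fintype.card V) ^ T))
      (fun H => H = G) (Prepared N₀ δ u) := by
  refine Reaches.forall fun v => (reaches_joined v T).mono ?_ (fun _ h => h) le_rfl
  rintro _ rfl
  exact ⟨hP, Or.inr (Or.inr (hG v))⟩

lemma reaches_prepared_of_far [Nonempty V] {G : SimpleGraph V} (hP : Phase N₀ δ u G)
    {x y : V} (hx : Close u G x) (hy : ¬ Close u G y) (hxy : y ∈ nbr G x)
    (hs : Strong N₀ δ G y) (T : ℕ) :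
    Reaches (T + T) (Fintype.card V * decay (Fintype.card V) ^ T +
      Fintype.card V * decay (Fintype.card V) ^ T)
      (fun H => H = G) (Prepared N₀ δ u) := by
  have hI : ∀ G H : SimpleGraph V, (Strong N₀ δ G y ∧ y ∈ nbr G x) → G ≤ H →
      (Strong N₀ δ H y ∧ y ∈ nbr H x) :=
    fun _ _ h hGH => ⟨h.1.mono hGH, nbr_mono hGH x h.2⟩
  have h₁ := (reaches_joined (N₀ := N₀) (δ := δ) (u := u) x T).and_monotone hI
  have h₂ := (reaches_joined (N₀ := N₀) (δ := δ) (u := u) y T).and_monotone hI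
  refine ((h₁.mono (A' := fun H => H = G) ?_ ?_ le_rfl).trans (decay_pow_nonneg _ T) h₂).mono
    (fun _ h => h) ?_ le_rfl
  · rintro _ rfl
    exact ⟨⟨hP, Or.inr (Or.inr hx)⟩, hs, hxy⟩
  · rintro H ⟨⟨hPH, hH⟩, hsH, hxyH⟩
    refine ⟨⟨hPH, ?_⟩, hsH, hxyH⟩
    rcases hH with h | h | h | h
    · exact Or.inl h
    · exact Or.inr (Or.inl h)
    · exact Or.inr (Or.inr (Or.inr (Or.inl (h ▸ hxyH))))
    · exact Or.inr (Or.inr (Or.inr (Or.inr ⟨x, Finset.mem_inter.2 ⟨h, nbr_comm.1 hxyH⟩⟩)))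
  · rintro H ⟨⟨hPH, hH⟩, hsH, -⟩
    refine Prepared.of_not_poor_or hPH ?_
    rcases hH with h | h | h | h
    · exact Or.inl h
    · exact Or.inr h
    · exact absurd (Or.inl h) hy
    · exact Or.inr ⟨y, Finset.mem_filter.2 ⟨h, hsH⟩⟩

lemma strong_of_not_close {G : SimpleGraph V} (hP : Phase (insert u (nbr G u)) δ u G) {y : V}
    (hy : ¬ Close u G y) : Strong (insert u (nbr G u)) δ G y := by
  have hdisj : nbr G y \ insert u (nbr G u) = nbr G y := by
    refine Finset.sdiff_eq_self_of_disjoint (Finset.disjoint_left.2 fun w hw hw' => hy ?_)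
    rcases Finset.mem_insert.1 hw' with rfl | hw'
    · exact Or.inr (Or.inl (nbr_comm.1 hw))
    · exact Or.inr (Or.inr ⟨w, Finset.mem_inter.2 ⟨hw', hw⟩⟩)
  have h1 := hP.le_deg y
  have h2 := hP.one_le
  unfold Strong
  rw [hdisj]
  change δ / 4 ≤ (deg G y : ℝ)
  linarith

lemma reaches_prepared [Nonempty V] {G : SimpleGraph V} (hG : G.Connected)
    (hP : Phase (insert u (nbr G u)) δ u G) (T : ℕ) :
    Reaches (T + T) ((Fintype.card V + 2) * (Fintype.card V * decay (Fintype.card V) ^ T))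
      (fun H => H = G) (Prepared (insert u (nbr G u)) δ u) := by
  have hε := decay_pow_nonneg (Fintype.card V) T
  have hn : (0 : ℝ) ≤ Fintype.card V := Nat.cast_nonneg _
  by_cases hc : ∀ v, Close u G v
  · refine ((reaches_prepared_of_close hP hc T).trans le_rfl (reaches_self_of_monotone
      (fun _ _ h hGH v => (h v).mono hGH) T)).mono (fun _ h => h) (fun _ h => h) ?_
    linarith
  · push Not at hc
    obtain ⟨z, hz⟩ := hc
    obtain ⟨p⟩ := hG.preconnected u z
    obtain ⟨d, -, hd₁, hd₂⟩ := p.exists_boundary_dart {v | Close u G v} (Or.inl rfl) hz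
    refine (reaches_prepared_of_far hP hd₁ hd₂ (mem_nbr.2 d.adj) (strong_of_not_close hP hd₂)
      T).mono (fun _ h => h) (fun _ h => h) ?_
    nlinarith

/-- `u` has gained a constant fraction of `δ` neighbors or is adjacent to every other vertex. -/
def Enriched (δ : ℝ) (u : V) (H : SimpleGraph V) : Prop :=
  9 / 8 * δ ≤ deg H u ∨ deg H u + 1 = Fintype.card V

lemma Enriched.mono {G H : SimpleGraph V} (h : Enriched δ u G) (hGH : G ≤ H) :
    Enriched δ u H := by
  rcases h with h | h
  · exact Or.inl (h.trans (by exact_mod_cast deg_mono hGH u))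
  · refine Or.inr (le_antisymm ?_ (h ▸ Nat.add_le_add_right (deg_mono hGH u) 1))
    rw [← card_insert_nbr]
    exact Finset.card_le_univ _

lemma reaches_enriched_of_prepared [Nonempty V] (N₀ : Finset V) (δ : ℝ) (u : V) (T : ℕ) :
    Reaches T (2 * Fintype.card V * decay (Fintype.card V) ^ T)
      (Prepared N₀ δ u) (Enriched δ u) := by
  intro G hG
  have hP := (hG u).1
  by_cases hS : (strongNbr N₀ δ G u).Nonempty
  · exact (reaches_not_poor N₀ δ u T).mono (A' := fun H => H = G)
      (by rintro _ rfl; exact ⟨hP, hS⟩) (fun _ h => Or.inl (not_lt.1 h)) le_rfl G rfl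
  · have hE : Enriched δ u G := by
      by_cases hp : Poor δ u G
      · refine Or.inr ?_
        rw [← card_insert_nbr, ← Finset.card_univ]
        congr 1
        ext v
        have := (hG v).2
        simp only [Finset.mem_insert, Finset.mem_univ, iff_true]
        tauto
      · exact Or.inl (not_lt.1 hp)
    refine (reaches_self_of_monotone (fun _ _ h hGH => Enriched.mono h hGH) T G hE).trans ?_
    linarith [decay_pow_nonneg (Fintype.card V) T]

lemma reaches_enriched [Nonempty V] {δ : ℝ} (hδ : 1 ≤ δ) (u : V) (T : ℕ) :
    Reaches (T + T + T) ((Fintype.card V + 4) * (Fintype.card V * decay (Fintype.card V) ^ T))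
      (fun G => G.Connected ∧ ∀ v, δ ≤ deg G v) (Enriched δ u) := by
  rintro G ⟨hG, hd⟩
  have hP : Phase (insert u (nbr G u)) δ u G := by
    refine ⟨hδ, hd, subset_rfl, ?_⟩
    rw [card_insert_nbr]
    push_cast
    linarith [hd u]
  have h := (reaches_prepared hG hP T).trans
    (by linarith [decay_pow_nonneg (Fintype.card V) T])
    (reaches_enriched_of_prepared (insert u (nbr G u)) δ u T)
  refine (h G rfl).trans (le_of_eq ?_)
  ring

end SingleVertex

/-- `G` is connected and all degrees are at least `(9 / 8) ^ k`, or as large as possible. -/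
def Level (k : ℕ) (G : SimpleGraph V) : Prop :=
  G.Connected ∧ ∀ u, min ((9 / 8 : ℝ) ^ k) (Fintype.card V - 1) ≤ deg G u

omit [DecidableEq V] in
lemma level_zero {G : SimpleGraph V} (hG : G.Connected) (hn : 2 ≤ Fintype.card V) :
    Level 0 G := by
  refine ⟨hG, fun u => (min_le_left _ _).trans ?_⟩
  have : Nontrivial V := Fintype.one_lt_card_iff_nontrivial.1 hn
  obtain ⟨v, hv⟩ := hG.preconnected.exists_adj_of_nontrivial u
  have : 0 < deg G u := Finset.card_pos.2 ⟨v, mem_nbr.2 hv⟩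
  rw [pow_zero]
  exact_mod_cast this

/-- Upper bound on the probability that some vertex fails to enrich within `3 * T` rounds. -/
def levelError (n T : ℕ) : ℝ := n * ((n + 4) * (n * decay n ^ T))

lemma levelError_nonneg (n T : ℕ) : 0 ≤ levelError n T :=
  mul_nonneg n.cast_nonneg (mul_nonneg (by positivity) (decay_pow_nonneg n T))

lemma reaches_level_succ (hn : 2 ≤ Fintype.card V) (k T : ℕ) :
    Reaches (V := V) (T + T + T) (levelError (Fintype.card V) T) (Level k) (Level (k + 1)) := by
  have : Nonempty V := Fintype.card_pos_iff.1 (by omega)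
  have hn' : (2 : ℝ) ≤ Fintype.card V := by exact_mod_cast hn
  have hδ : 1 ≤ min ((9 / 8 : ℝ) ^ k) (Fintype.card V - 1) :=
    le_min (one_le_pow₀ (by norm_num)) (by linarith)
  refine ((Reaches.forall fun u => reaches_enriched hδ u T).and_monotone
    (I := SimpleGraph.Connected) (fun _ _ h hGH => h.mono hGH)).mono
    (fun G h => ⟨h, h.1⟩) ?_ le_rfl
  rintro H ⟨hH, hc⟩
  refine ⟨hc, fun u => ?_⟩
  rcases hH u with h | h
  · refine le_trans ?_ h
    rw [mul_min_of_nonneg _ _ (by norm_num)]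
    refine min_le_min (le_of_eq (by ring)) (by linarith)
  · refine (min_le_right _ _).trans ?_
    have : (deg H u : ℝ) + 1 = Fintype.card V := by exact_mod_cast h
    linarith

lemma reaches_level (hn : 2 ≤ Fintype.card V) (K T : ℕ) :
    Reaches (V := V) (K * (T + T + T)) (K * levelError (Fintype.card V) T) (Level 0) (Level K) := by
  induction K with
  | zero =>
    intro G hG
    simp [failProb, hG]
  | succ K ih =>
    have h := ih.trans (levelError_nonneg _ T) (reaches_level_succ hn K T)
    rw [Nat.succ_mul]
    push_cast
    rwa [add_one_mul]

omit [DecidableEq V] in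
lemma Level.eq_top {K : ℕ} {G : SimpleGraph V} (h : Level K G)
    (hK : (Fintype.card V : ℝ) ≤ (9 / 8) ^ K) : G = ⊤ := by
  classical
  ext u v
  refine ⟨fun h => h.ne, fun huv => ?_⟩
  have h1 := h.2 u
  rw [min_eq_right (by linarith)] at h1
  have h2 : Fintype.card V ≤ (insert u (nbr G u)).card := by
    rw [card_insert_nbr]
    have : (Fintype.card V : ℝ) ≤ deg G u + 1 := by linarith
    exact_mod_cast this
  have h3 := Finset.eq_univ_of_card _ (le_antisymm (Finset.card_le_univ _) h2)
  have h4 : v ∈ insert u (nbr G u) := h3 ▸ Finset.mem_univ v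
  rcases Finset.mem_insert.1 h4 with h5 | h5
  · exact absurd h5.symm huv
  · exact mem_nbr.1 h5

lemma trajProb_triStep_top (G : SimpleGraph V) (T : ℕ) :
    trajProb triStep G T (fun g => g T = ⊤) = 1 - failProb T (fun H => H = ⊤) G := by
  have h := iterate_const 1 T G
  rw [trajProb_eq_iterate, markovOp_triStep, eq_sub_iff_add_eq, failProb, ← iterate_add]
  convert h using 3 with H
  by_cases hH : H = ⊤ <;> simp [hH]

lemma decay_pow_le {n T : ℕ} (hn : 2 ≤ n) (hT : 25000 * n * Real.log n ≤ T) :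
    decay n ^ T ≤ 1 / (n : ℝ) ^ 5 := by
  have hn0 : (0 : ℝ) < n := by positivity
  have h1 : decay n ≤ Real.exp (-(1 / (5000 * n))) := by
    have := Real.add_one_le_exp (-(1 / (5000 * (n : ℝ))))
    unfold decay
    linarith
  calc decay n ^ T ≤ Real.exp (-(1 / (5000 * n))) ^ T :=
        pow_le_pow_left₀ (decay_nonneg n) h1 T
    _ = Real.exp (-(T / (5000 * n))) := by
        rw [← Real.exp_nat_mul]; congr 1; ring
    _ ≤ Real.exp (-(5 * Real.log n)) := by
        refine Real.exp_le_exp.2 (neg_le_neg ?_)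
        rw [le_div_iff₀ (by positivity)]
        linarith
    _ = 1 / (n : ℝ) ^ 5 := by
        rw [Real.exp_neg, show (5 : ℝ) * Real.log n = (5 : ℕ) * Real.log n by norm_num,
          Real.exp_nat_mul, Real.exp_log hn0, one_div]

lemma levelError_le {n T : ℕ} (hn : 2 ≤ n) (hT : 25000 * n * Real.log n ≤ T) :
    levelError n T ≤ 3 / n := by
  have hn' : (2 : ℝ) ≤ n := by exact_mod_cast hn
  have h := decay_pow_le hn hT
  calc levelError n T ≤ n * ((n + 4) * (n * (1 / (n : ℝ) ^ 5))) := by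
        unfold levelError; gcongr
    _ = (n + 4) / (n : ℝ) ^ 2 * (1 / n) := by field_simp
    _ ≤ 3 * (1 / n) := by
        gcongr
        rw [div_le_iff₀ (by positivity)]
        nlinarith
    _ = 3 / n := by ring

lemma le_nine_eighths_pow {n K : ℕ} (hn : 2 ≤ n) (hK : 9 * Real.log n ≤ K) :
    (n : ℝ) ≤ (9 / 8) ^ K := by
  have hn0 : (0 : ℝ) < n := by positivity
  have h := Real.one_sub_inv_le_log_of_pos (show (0 : ℝ) < 9 / 8 by norm_num)
  rw [← Real.log_le_log_iff hn0 (by positivity), Real.log_pow]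
  nlinarith [K.cast_nonneg (α := ℝ)]

lemma reaches_top {n T : ℕ} (hn : 2 ≤ n) (hV : Fintype.card V = n)
    (hT : 825033 * n * Real.log n ^ 2 ≤ T) :
    Reaches (V := V) T (33 * Real.log n / n) SimpleGraph.Connected (fun H => H = ⊤) := by
  have hn' : (2 : ℝ) ≤ n := by exact_mod_cast hn
  have hL : 1 / 2 ≤ Real.log n :=
    (by linarith [Real.log_two_gt_d9] : (1 : ℝ) / 2 ≤ Real.log 2).trans
      (Real.log_le_log (by norm_num) hn')
  set L := Real.log n with hLdef
  set S := ⌈25000 * n * L⌉₊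
  set K := ⌈9 * L⌉₊
  have hS₁ : 25000 * n * L ≤ S := Nat.le_ceil _
  have hS₂ : (S : ℝ) ≤ 25001 * n * L := by
    have := Nat.ceil_lt_add_one (show 0 ≤ 25000 * n * L by positivity)
    nlinarith
  have hK₁ : 9 * L ≤ K := Nat.le_ceil _
  have hK₂ : (K : ℝ) ≤ 11 * L := by
    have := Nat.ceil_lt_add_one (show 0 ≤ 9 * L by positivity)
    linarith
  have hle : K * (S + S + S) ≤ T := by
    have : (K : ℝ) * (S + S + S) ≤ T := by
      refine le_trans ?_ hT
      calc (K : ℝ) * (S + S + S) = 3 * (K * S) := by ring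
        _ ≤ 3 * (11 * L * (25001 * n * L)) := by gcongr
        _ = 825033 * n * L ^ 2 := by ring
    exact_mod_cast this
  have hlevel := (reaches_level (V := V) (by omega) K S).trans le_rfl
    ((reaches_self_of_monotone (A := fun H : SimpleGraph V => H = ⊤)
      (fun _ _ h hGH => top_le_iff.1 (h ▸ hGH)) (T - K * (S + S + S))).mono
      (fun H h => Level.eq_top h (hV ▸ le_nine_eighths_pow hn hK₁)) (fun _ h => h) le_rfl)
  rw [Nat.add_sub_cancel' hle, add_zero, hV] at hlevel
  refine hlevel.mono (fun G hG => level_zero hG (by omega)) (fun _ h => h) ?_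
  calc (K : ℝ) * levelError n S ≤ 11 * L * (3 / n) :=
        mul_le_mul hK₂ (levelError_le hn hS₁) (levelError_nonneg n S) (by positivity)
    _ = 33 * L / n := by ring
end
end Triangulation

/-- There are constants `C > 0` and `C' > 0` such that for every
`n ≥ 2` and every connected initial graph `G₀` on `n` vertices, after
`T = ⌈C·n·(ln n)²⌉` rounds of the triangulation process, the graph `G_T` is the
complete graph with probability at least `1 − C'·(ln n)/n`. -/
theorem triangulation_upper_bound :
    ∃ C : ℝ, 0 < C ∧ ∃ C' : ℝ, 0 < C' ∧
      ∀ (V : Type) [Fintype V] [DecidableEq V] (n : ℕ), 2 ≤ n → Fintype.card V = n →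
        ∀ (G0 : SimpleGraph V), G0.Connected →
          ∀ T : ℕ, T = ⌈C * n * (Real.log n) ^ 2⌉₊ →
            1 - C' * Real.log n / n ≤
              trajProb triStep G0 T (fun g => g T = (⊤ : SimpleGraph V)) := by
  refine ⟨825033, by norm_num, 33, by norm_num, ?_⟩
  intro V _ _ n hn hV G0 hG T hT
  have h := Triangulation.reaches_top hn hV (hT ▸ Nat.le_ceil _) G0 hG
  rw [Triangulation.trajProb_triStep_top]
  linarith
end
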